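/- arXiv:2106.12418 — 5 statements merged into one kernel-verified Lean document; each statement's English description precedes it below -/
import Mathlib

section
/- Let X be a regular curve. Then for every ε > 0 and every family (A_i)_{i ∈ I} of pairwise disjoint subcontinua of X, the set {i ∈ I : diam(A_i) ≥ ε} is finite. -/
open Set Filter Metric Topology Function

/-- A regular curve: every point has arbitrarily small open neighborhoods
with finite topological boundary (to be used on a compact connected
nonempty metric space, i.e. a continuum). -/
def IsRegCurve (X : Type*) [TopologicalSpace X] : Prop :=
  ∀ (x : X) (V : Set X), IsOpen V → x ∈ V →
    ∃ U : Set X, IsOpen U ∧ x ∈ U ∧ U ⊆ V ∧ (frontier U).Finite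

/-- A monotone continuous self-map: continuous and preimages of connected
sets are connected. -/
def IsMonotoneMap {X : Type*} [TopologicalSpace X] (f : X → X) : Prop :=
  Continuous f ∧ ∀ C : Set X, IsPreconnected C → IsPreconnected (f ⁻¹' C)

/-- The ω-limit set of a point: ⋂ₙ closure {f^k(x) : k ≥ n}. -/
def omegaLimitSet {X : Type*} [TopologicalSpace X] (f : X → X) (x : X) : Set X :=
  ⋂ n : ℕ, closure ((fun k => f^[k] x) '' Set.Ici n)

/-- The α-limit set of a point: ⋂ₖ closure (⋃_{n ≥ k} f⁻ⁿ({x})). -/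
def alphaLimitSet {X : Type*} [TopologicalSpace X] (f : X → X) (x : X) : Set X :=
  ⋂ k : ℕ, closure (⋃ n ∈ Set.Ici k, f^[n] ⁻¹' {x})

/-- limsup of a sequence of sets: ⋂ₖ closure (⋃_{n ≥ k} G n). -/
def limsupSet {X : Type*} [TopologicalSpace X] (G : ℕ → Set X) : Set X :=
  ⋂ k : ℕ, closure (⋃ n ∈ Set.Ici k, G n)

/-- A minimal set of `f`: nonempty, closed, invariant, and with no proper
nonempty closed invariant subset. -/
def IsMinimalSet {X : Type*} [TopologicalSpace X] (f : X → X) (M : Set X) : Prop :=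
  M.Nonempty ∧ IsClosed M ∧ f '' M ⊆ M ∧
    ∀ A : Set X, A ⊆ M → A.Nonempty → IsClosed A → f '' A ⊆ A → A = M

/-- A periodic point of `f`. -/
def IsPeriodicPoint {X : Type*} (f : X → X) (x : X) : Prop :=
  ∃ n : ℕ, 1 ≤ n ∧ f^[n] x = x

/-- The set of limit (cluster) points of a sequence. -/
def seqLimitPoints {X : Type*} [TopologicalSpace X] (u : ℕ → X) : Set X :=
  {y : X | MapClusterPt y Filter.atTop u}

theorem stmt_0 {X : Type*} [MetricSpace X] [CompactSpace X] [ConnectedSpace X]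
    (hX : IsRegCurve X) {I : Type*} (A : I → Set X)
    (hA : ∀ i, IsCompact (A i) ∧ IsConnected (A i))
    (hdisj : Pairwise (Disjoint on A))
    (ε : ℝ) (hε : 0 < ε) :
    {i : I | ε ≤ Metric.diam (A i)}.Finite := by
  choose! U hUo hxU hUs hUf using fun x : X => hX x (ball x (ε / 3)) isOpen_ball
    (mem_ball_self (by positivity))
  obtain ⟨t, -, ht⟩ := isCompact_univ.elim_nhds_subcover U
    (fun x _ => (hUo x).mem_nhds (hxU x))
  have hF : (⋃ x ∈ t, frontier (U x)).Finite :=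
    t.finite_toSet.biUnion (fun x _ => hUf x)
  have key : ∀ i ∈ {i : I | ε ≤ Metric.diam (A i)}, ∃ y, y ∈ A i ∧ y ∈ ⋃ x ∈ t, frontier (U x) := by
    intro i hi
    obtain ⟨a, ha⟩ := (hA i).2.nonempty
    have := ht (mem_univ a)
    simp only [mem_iUnion] at this
    obtain ⟨x, hxt, hax⟩ := this
    have hn : ¬ A i ⊆ U x := by
      intro h
      have h1 : Metric.diam (A i) ≤ Metric.diam (ball x (ε / 3)) :=
        Metric.diam_mono (h.trans (hUs x)) isBounded_ball
      have h2 : Metric.diam (ball x (ε / 3)) ≤ 2 * (ε / 3) := Metric.diam_ball (by positivity)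
      have h3 : ε ≤ Metric.diam (A i) := hi
      linarith
    obtain ⟨b, hb, hbx⟩ := not_subset.mp hn
    by_contra hc
    push Not at hc
    have hfr : ∀ y ∈ A i, y ∉ frontier (U x) := fun y hy hyf =>
      hc y hy (mem_iUnion₂.mpr ⟨x, hxt, hyf⟩)
    have hcl : ∀ y ∈ A i, y ∉ U x → y ∈ (closure (U x))ᶜ := by
      intro y hy hyU hycl
      exact hfr y hy (by rw [(hUo x).frontier_eq]; exact ⟨hycl, hyU⟩)
    obtain ⟨z, -, hz1, hz2⟩ := (hA i).2.isPreconnected (U x) (closure (U x))ᶜ (hUo x)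
      isClosed_closure.isOpen_compl
      (fun y hy => by
        by_cases h : y ∈ U x
        · exact Or.inl h
        · exact Or.inr (hcl y hy h))
      ⟨a, ha, hax⟩ ⟨b, hb, hcl b hb hbx⟩
    exact hz2 (subset_closure hz1)
  have : Nonempty X := inferInstance
  choose! f hf1 hf2 using key
  refine Set.Finite.of_injOn (f := f) hf2 ?_ hF
  intro i hi j hj hij
  by_contra hne
  exact Set.disjoint_left.mp (hdisj hne) (hf1 i hi) (hij ▸ hf1 j hj)
end

section
/- Let X be a regular curve and let (A_n)_{n ≥ 0} be a sequence of pairwise disjoint subcontinua of X. Then diam(A_n) → 0 as n → ∞. -/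
open Set Filter Metric Topology Function

theorem stmt_1 {X : Type*} [MetricSpace X] [CompactSpace X] [ConnectedSpace X]
    (hX : IsRegCurve X) (A : ℕ → Set X)
    (hA : ∀ n, IsCompact (A n) ∧ IsConnected (A n))
    (hdisj : Pairwise (Disjoint on A)) :
    Filter.Tendsto (fun n => Metric.diam (A n)) Filter.atTop (𝓝 0) := by
  rw [Metric.tendsto_nhds]
  intro ε hε
  choose U hUo hxU hUs hUf using fun x : X =>
    hX x (ball x (ε / 3)) isOpen_ball (mem_ball_self (by positivity))
  obtain ⟨t, ht⟩ := isCompact_univ.elim_finite_subcover U hUo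
    (fun x _ => mem_iUnion.2 ⟨x, hxU x⟩)
  have hF : (⋃ x ∈ t, frontier (U x)).Finite := t.finite_toSet.biUnion (fun x _ => hUf x)
  have hB : {n | (A n ∩ ⋃ x ∈ t, frontier (U x)).Nonempty}.Finite := by
    choose! g hg using fun (n : ℕ) (h : (A n ∩ ⋃ x ∈ t, frontier (U x)).Nonempty) => h
    refine Set.Finite.of_injOn (f := g) (fun n hn => (hg n hn).2) ?_ hF
    intro m hm n hn hmn
    by_contra hne
    exact Set.disjoint_left.1 (hdisj hne) (hg m hm).1 (hmn ▸ (hg n hn).1)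
  rw [← Nat.cofinite_eq_atTop]
  filter_upwards [hB.compl_mem_cofinite] with n hn
  obtain ⟨y, hy⟩ := (hA n).2.nonempty
  obtain ⟨x, hx, hyx⟩ := mem_iUnion₂.1 (ht (mem_univ y))
  have hsub : A n ⊆ U x := by
    by_contra hns
    obtain ⟨z, hz, hzU⟩ := not_subset.1 hns
    have hcov : A n ⊆ U x ∪ (closure (U x))ᶜ := by
      intro w hw
      by_contra hc
      simp only [mem_union, mem_compl_iff, not_or, not_not] at hc
      refine hn ⟨w, hw, mem_iUnion₂.2 ⟨x, hx, ?_⟩⟩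
      rw [(hUo x).frontier_eq]
      exact ⟨hc.2, hc.1⟩
    obtain ⟨w, _, h1, h2⟩ := (hA n).2.isPreconnected (U x) (closure (U x))ᶜ (hUo x)
      isClosed_closure.isOpen_compl hcov ⟨y, hy, hyx⟩ ⟨z, hz, (hcov hz).resolve_left hzU⟩
    exact h2 (subset_closure h1)
  have h1 : diam (A n) ≤ 2 * (ε / 3) :=
    (diam_mono (hsub.trans (hUs x)) isBounded_ball).trans (diam_ball (by positivity))
  rw [Real.dist_eq, sub_zero, abs_of_nonneg diam_nonneg]
  linarith
end

section
/- Let X be a regular curve and f : X → X a monotone continuous map. Then for every x ∈ X, the ω-limit set ω_f(x) is a minimal set of f. -/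
open Set Filter Metric Topology Function

def BigS {X : Type*} [MetricSpace X] (ε : ℝ) (S : Set X) : Prop :=
  ∃ u ∈ S, ∃ v ∈ S, ε ≤ dist u v

theorem exists_bound {X : Type*} [MetricSpace X] [CompactSpace X] (hX : IsRegCurve X)
    {ε : ℝ} (hε : 0 < ε) :
    ∃ N : ℕ, ∀ (s : Finset ℕ) (S : ℕ → Set X),
      (∀ i ∈ s, IsPreconnected (S i)) → (∀ i ∈ s, BigS ε (S i)) →
      (∀ i ∈ s, ∀ j ∈ s, i < j → Disjoint (S i) (S j)) → s.card ≤ N := by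
  choose U hUo hxU hUb hUf using fun x : X => hX x (ball x (ε/2)) isOpen_ball
    (mem_ball_self (half_pos hε))
  obtain ⟨t, ht⟩ := isCompact_univ.elim_finite_subcover U hUo
    (fun x _ => mem_iUnion.2 ⟨x, hxU x⟩)
  have hF : (⋃ x ∈ t, frontier (U x)).Finite := t.finite_toSet.biUnion (fun x _ => hUf x)
  refine ⟨hF.toFinset.card, fun s S hc hb hd => ?_⟩
  have key : ∀ i ∈ s, ∃ w, w ∈ S i ∧ w ∈ ⋃ x ∈ t, frontier (U x) := by
    intro i hi
    obtain ⟨u, hu, v, hv, huv⟩ := hb i hi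
    have := ht (mem_univ u)
    simp only [mem_iUnion] at this
    obtain ⟨x, hx, hux⟩ := this
    have hvU : v ∉ U x := by
      intro hvx
      have h1 := mem_ball.1 (hUb x hux)
      have h2 := mem_ball.1 (hUb x hvx)
      have := dist_triangle_right u v x
      linarith
    have : (S i ∩ frontier (U x)).Nonempty := by
      by_contra hne
      rw [not_nonempty_iff_eq_empty, ← disjoint_iff_inter_eq_empty] at hne
      have h3 : S i ⊆ U x ∪ (closure (U x))ᶜ := by
        intro z hz
        by_cases h : z ∈ U x
        · exact Or.inl h
        · right
          intro hz2
          exact hne.le_bot ⟨hz, by rw [(hUo x).frontier_eq]; exact ⟨hz2, h⟩⟩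
      obtain ⟨z, -, hz1, hz2⟩ := hc i hi (U x) (closure (U x))ᶜ (hUo x)
        isClosed_closure.isOpen_compl h3 ⟨u, hu, hux⟩
        ⟨v, hv, (h3 hv).resolve_left hvU⟩
      exact hz2 (subset_closure hz1)
    obtain ⟨w, hw1, hw2⟩ := this
    exact ⟨w, hw1, by simp only [mem_iUnion]; exact ⟨x, hx, hw2⟩⟩
  rcases s.eq_empty_or_nonempty with rfl | ⟨i0, hi0⟩
  · simp
  have : Nonempty X := ⟨(key i0 hi0).choose⟩
  choose! w hw1 hw2 using key
  apply Finset.card_le_card_of_injOn w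
  · intro i hi
    simpa using hw2 i hi
  · intro i hi j hj hij
    by_contra hne
    rcases lt_or_gt_of_ne hne with h | h
    · exact (hd i hi j hj h).le_bot ⟨hw1 i hi, by rw [hij]; exact hw1 j hj⟩
    · exact (hd j hj i hi h).le_bot ⟨hw1 j hj, by rw [← hij]; exact hw1 i hi⟩

theorem bump {X : Type*} [MetricSpace X] [CompactSpace X] [ConnectedSpace X]
    {U : Set X} (hU : IsOpen U) (hne : (frontier U).Nonempty) {u : X} (hu : u ∈ closure U) :
    (connectedComponentIn (closure U) u ∩ frontier U).Nonempty := by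
  by_contra hcon
  rw [not_nonempty_iff_eq_empty, ← disjoint_iff_inter_eq_empty] at hcon
  let F := closure U
  have : CompactSpace F := isCompact_iff_compactSpace.1 isClosed_closure.isCompact
  let u' : F := ⟨u, hu⟩
  let O : Set F := Subtype.val ⁻¹' (frontier U)ᶜ
  have hO : IsOpen O := isClosed_frontier.isOpen_compl.preimage continuous_subtype_val
  have hsub : (⋂ s : { s : Set F // IsClopen s ∧ u' ∈ s }, (s : Set F)) ⊆ O := by
    rw [← connectedComponent_eq_iInter_isClopen]
    intro z hz
    have : (z : X) ∈ connectedComponentIn F u := by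
      rw [connectedComponentIn_eq_image hu]
      exact ⟨z, hz, rfl⟩
    exact fun h => hcon.le_bot ⟨this, h⟩
  have hdir : Directed (· ⊇ ·) (fun s : { s : Set F // IsClopen s ∧ u' ∈ s } => (s : Set F)) := by
    intro s t
    exact ⟨⟨s ∩ t, s.2.1.inter t.2.1, s.2.2, t.2.2⟩, inter_subset_left, inter_subset_right⟩
  have : Nonempty { s : Set F // IsClopen s ∧ u' ∈ s } := ⟨⟨univ, isClopen_univ, mem_univ _⟩⟩
  obtain ⟨⟨Z, hZ, huZ⟩, hZO⟩ := exists_subset_nhds_of_compactSpace hdir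
    (fun s => s.2.1.1) (U := O) (fun z hz => hO.mem_nhds (hsub hz))
  have hZU : Subtype.val '' Z ⊆ U := by
    rintro _ ⟨z, hz, rfl⟩
    by_contra h
    exact hZO hz (by rw [hU.frontier_eq]; exact ⟨z.2, h⟩)
  have hcl : IsClosed (Subtype.val '' Z) :=
    (isClosed_closure (s := U)).isClosedEmbedding_subtypeVal.isClosedMap _ hZ.1
  have hop : IsOpen (Subtype.val '' Z) := by
    obtain ⟨G, hG, hGZ⟩ := isOpen_induced_iff.1 hZ.2
    have : Subtype.val '' Z = G ∩ U := by
      ext z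
      constructor
      · intro hz
        refine ⟨?_, hZU hz⟩
        obtain ⟨z', hz', rfl⟩ := hz
        rw [← hGZ] at hz'
        exact hz'
      · rintro ⟨h1, h2⟩
        refine ⟨⟨z, subset_closure h2⟩, ?_, rfl⟩
        rw [← hGZ]; exact h1
    rw [this]; exact hG.inter hU
  have : Subtype.val '' Z = univ := IsClopen.eq_univ ⟨hcl, hop⟩ ⟨u, u', huZ, rfl⟩
  have hUu : U = univ := by rw [this] at hZU; exact univ_subset_iff.1 hZU
  rw [hUu] at hne
  simp at hne

theorem exists_conn_nhd {X : Type*} [MetricSpace X] [CompactSpace X] [ConnectedSpace X]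
    (hX : IsRegCurve X) (x : X) {G : Set X} (hG : G ∈ 𝓝 x) :
    ∃ V ∈ 𝓝 x, V ⊆ G ∧ IsPreconnected V := by
  obtain ⟨ε, hε, hεG⟩ := Metric.nhds_basis_closedBall.mem_iff.1 hG
  obtain ⟨U, hU, hxU, hUb, hUf⟩ := hX x (ball x ε) isOpen_ball (mem_ball_self hε)
  have hcl : closure U ⊆ G :=
    (closure_minimal (hUb.trans ball_subset_closedBall) isClosed_closedBall).trans hεG
  by_cases hne : (frontier U).Nonempty
  swap
  · have : IsClopen U := by
      rw [not_nonempty_iff_eq_empty] at hne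
      exact isClopen_iff_frontier_eq_empty.2 hne
    have hu := this.eq_univ ⟨x, hxU⟩
    exact ⟨univ, univ_mem, by rw [← hu]; exact subset_closure.trans hcl, isPreconnected_univ⟩
  refine ⟨connectedComponentIn (closure U) x, ?_, (connectedComponentIn_subset _ _).trans hcl,
    isPreconnected_connectedComponentIn⟩
  set K := connectedComponentIn (closure U) x with hK
  have hxc := subset_closure hxU
  have hfc : frontier U ⊆ closure U := frontier_subset_closure
  have hclosed : ∀ w ∈ closure U, IsClosed (connectedComponentIn (closure U) w) :=
    fun w hw => by
      rw [connectedComponentIn_eq_image hw]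
      exact isClosed_closure.isClosedEmbedding_subtypeVal.isClosedMap _ isClosed_connectedComponent
  have hC : IsClosed (⋃ w ∈ frontier U \ K, connectedComponentIn (closure U) w) :=
    (hUf.subset sdiff_subset).isClosed_biUnion (fun w hw => hclosed w (hfc hw.1))
  have hxC : x ∉ ⋃ w ∈ frontier U \ K, connectedComponentIn (closure U) w := by
    simp only [mem_iUnion, not_exists]
    intro w hw hx
    apply hw.2
    rw [hK, ← connectedComponentIn_eq hx]
    exact mem_connectedComponentIn (hfc hw.1)
  filter_upwards [hU.mem_nhds hxU, hC.isOpen_compl.mem_nhds hxC] with z hzU hzC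
  obtain ⟨w, hw1, hw2⟩ := bump hU hne (subset_closure hzU)
  have he := connectedComponentIn_eq hw1
  by_cases hwK : w ∈ K
  · rw [hK, connectedComponentIn_eq hwK, ← he]
    exact mem_connectedComponentIn (subset_closure hzU)
  · exfalso
    apply hzC
    simp only [mem_iUnion]
    exact ⟨w, ⟨hw2, hwK⟩, by rw [← he]; exact mem_connectedComponentIn (subset_closure hzU)⟩

theorem iter_pre {X : Type*} [TopologicalSpace X] {f : X → X} (hf : IsMonotoneMap f) (n : ℕ)
    {C : Set X} (hC : IsPreconnected C) : IsPreconnected (f^[n] ⁻¹' C) := by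
  induction n with
  | zero => simpa using hC
  | succ n ih => rw [iterate_succ, preimage_comp]; exact hf.2 _ ih

theorem mem_omega {X : Type*} [TopologicalSpace X] {f : X → X} {x y : X} :
    y ∈ omegaLimitSet f x ↔ ∀ G ∈ 𝓝 y, ∀ n, ∃ m ≥ n, f^[m] x ∈ G := by
  simp only [omegaLimitSet, mem_iInter, mem_closure_iff_nhds]
  constructor
  · intro h G hG n
    obtain ⟨z, hz, m, hm, rfl⟩ := h n G hG
    exact ⟨m, hm, hz⟩
  · intro h n G hG
    obtain ⟨m, hm, hz⟩ := h G hG n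
    exact ⟨_, hz, m, hm, rfl⟩

theorem mem_omega_of_tendsto {X : Type*} [TopologicalSpace X] {f : X → X} {x y : X}
    {𝒰 : Filter ℕ} [NeBot 𝒰] {φ : ℕ → ℕ} (hφ : Tendsto φ 𝒰 atTop)
    (h : Tendsto (fun n => f^[φ n] x) 𝒰 (𝓝 y)) : y ∈ omegaLimitSet f x := by
  rw [mem_omega]
  intro G hG n
  obtain ⟨m, h1, h2⟩ := ((h.eventually hG).and (hφ.eventually_ge_atTop n)).exists
  exact ⟨_, h2, h1⟩

theorem omega_ultra {X : Type*} [TopologicalSpace X] {f : X → X} {x y : X}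
    (hy : y ∈ omegaLimitSet f x) :
    ∃ 𝒰 : Ultrafilter ℕ, (𝒰 : Filter ℕ) ≤ atTop ∧ Tendsto (fun n => f^[n] x) 𝒰 (𝓝 y) := by
  have : MapClusterPt y atTop (fun n => f^[n] x) := by
    rw [mapClusterPt_iff_frequently]
    intro G hG
    rw [frequently_atTop]
    exact fun n => mem_omega.1 hy G hG n
  exact mapClusterPt_iff_ultrafilter.1 this

/-- backward orbits along an ultrafilter -/
theorem exists_back {X : Type*} [MetricSpace X] [CompactSpace X] {f : X → X}
    (hf : Continuous f) (x : X) {𝒰 : Ultrafilter ℕ} {φ : ℕ → ℕ} (hφ : Tendsto φ 𝒰 atTop) :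
    ∃ b : ℕ → X, (∀ i, Tendsto (fun n => f^[φ n - i] x) 𝒰 (𝓝 (b i))) ∧
      (∀ i, f (b (i+1)) = b i) ∧ ∀ i, b i ∈ omegaLimitSet f x := by
  have h : ∀ i, ∃ y, Tendsto (fun n => f^[φ n - i] x) 𝒰 (𝓝 y) := by
    intro i
    obtain ⟨y, -, hy⟩ := isCompact_univ.ultrafilter_le_nhds (𝒰.map (fun n => f^[φ n - i] x))
      (by simp)
    exact ⟨y, hy⟩
  choose b hb using h
  refine ⟨b, hb, fun i => ?_, fun i => ?_⟩
  · have h1 := (hf.tendsto _).comp (hb (i+1))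
    refine tendsto_nhds_unique (h1.congr' ?_) (hb i)
    filter_upwards [hφ.eventually_ge_atTop (i+1)] with n hn
    simp only [comp]
    rw [← iterate_succ_apply' f]
    congr 2
    omega
  · refine mem_omega_of_tendsto (φ := fun n => φ n - i) ?_ (hb i)
    exact (tendsto_sub_atTop_nat i).comp hφ

theorem back_iter {X : Type*} {f : X → X} {b : ℕ → X} (hb : ∀ i, f (b (i+1)) = b i) (n i : ℕ) :
    f^[n] (b (i + n)) = b i := by
  induction n generalizing i with
  | zero => rfl
  | succ n ih => rw [iterate_succ_apply, ← add_assoc, hb, ih]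

theorem omega_inv {X : Type*} [TopologicalSpace X] {f : X → X} (hf : Continuous f) {x y : X}
    (hy : y ∈ omegaLimitSet f x) : f y ∈ omegaLimitSet f x := by
  rw [mem_omega] at hy ⊢
  intro G hG n
  obtain ⟨m, hm, h⟩ := hy _ (hf.continuousAt hG) n
  exact ⟨m+1, by omega, by rw [iterate_succ_apply']; exact h⟩

theorem small_pre {X : Type*} [MetricSpace X] [CompactSpace X] {f : X → X} (hf : Continuous f)
    {y : X} {ε : ℝ} {i : ℕ} (h : ¬ BigS ε (f^[i] ⁻¹' {y})) :
    ∃ G ∈ 𝓝 y, ¬ BigS ε (f^[i] ⁻¹' G) := by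
  have hfi := hf.iterate i
  have hT : IsCompact {q : X × X | ε ≤ dist q.1 q.2} :=
    (isClosed_le continuous_const continuous_dist).isCompact
  obtain ⟨δ, hδ, hmin⟩ := hT.exists_forall_le' (a := 0)
    (f := fun q : X × X => max (dist (f^[i] q.1) y) (dist (f^[i] q.2) y))
    (by fun_prop) (by
      rintro ⟨u, v⟩ huv
      by_contra hle
      simp only [lt_max_iff, dist_pos, ne_eq, not_or, not_not] at hle
      exact h ⟨u, hle.1, v, hle.2, huv⟩)
  refine ⟨ball y δ, ball_mem_nhds y hδ, ?_⟩
  rintro ⟨u, hu, v, hv, huv⟩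
  have := hmin (u, v) huv
  exact absurd (max_lt (mem_ball.1 hu) (mem_ball.1 hv)) (not_lt.2 this)

theorem pre_disj {X : Type*} {f : X → X} {V : Set X} {R : ℕ}
    (hV : ∀ l, 1 ≤ l → l ≤ R → ∀ z ∈ V, f^[l] z ∉ V) {m n : ℕ} (h : m < n) (hR : n - m ≤ R) :
    Disjoint (f^[m] ⁻¹' V) (f^[n] ⁻¹' V) := by
  rw [Set.disjoint_left]
  intro z hz1 hz2
  refine hV (n - m) (by omega) hR _ hz1 ?_
  rw [← iterate_add_apply]
  have : n - m + m = n := by omega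
  rw [this]; exact hz2

/-- backward recurrence -/
theorem back_rec {X : Type*} [MetricSpace X] [CompactSpace X] [ConnectedSpace X]
    (hX : IsRegCurve X) {f : X → X} (hf : IsMonotoneMap f) {x y : X}
    (hy : y ∈ omegaLimitSet f x) (hper : ∀ r, 1 ≤ r → f^[r] y ≠ y)
    {b : ℕ → X} (hb : ∀ i, f (b (i+1)) = b i) (hb0 : b 0 = y) {ε₀ : ℝ} (hε₀ : 0 < ε₀) :
    ∃ i, 1 ≤ i ∧ dist (b i) y < ε₀ := by
  by_contra! hcon
  set ε := ε₀ / 3 with hεdef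
  have hε : 0 < ε := by positivity
  obtain ⟨N, hN⟩ := exists_bound hX hε
  have hbi : ∀ i, f^[i] (b i) = y := fun i => by
    have := back_iter hb i 0
    rwa [zero_add, hb0] at this
  -- only finitely many big fibres
  have hfin : ∃ K, ∀ i, K < i → ¬ BigS ε (f^[i] ⁻¹' {y}) := by
    have hF : {i | BigS ε (f^[i] ⁻¹' {y})}.Finite := by
      by_contra hinf
      obtain ⟨s, hs, hcard⟩ := Set.Infinite.exists_subset_card_eq hinf (N+1)
      have := hN s (fun i => f^[i] ⁻¹' {y}) (fun i _ => iter_pre hf i isPreconnected_singleton)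
        (fun i hi => hs hi) (fun i _ j _ hij => pre_disj (R := j)
          (fun l hl _ z hz => by
            rw [mem_singleton_iff] at hz ⊢
            rw [hz]; exact hper l hl) hij (by omega))
      omega
    obtain ⟨K, hK⟩ := hF.bddAbove
    exact ⟨K, fun i hi hbig => absurd (hK hbig) (by omega)⟩
  obtain ⟨K0, hK0⟩ := hfin
  have step : ∀ K : ℕ, ∃ (W : Set X) (m : ℕ), W ∈ 𝓝 y ∧ IsPreconnected W ∧ W ⊆ ball y ε ∧
      K < m ∧ K0 < m ∧ BigS ε (f^[m] ⁻¹' W) ∧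
      ∀ i, K0 < i → i < m → ¬ BigS ε (f^[i] ⁻¹' W) := by
    intro K
    have : ∀ i, ∃ G ∈ 𝓝 y, K0 < i → ¬ BigS ε (f^[i] ⁻¹' G) := by
      intro i
      by_cases hi : K0 < i
      · obtain ⟨G, hG, h⟩ := small_pre hf.1 (hK0 i hi)
        exact ⟨G, hG, fun _ => h⟩
      · exact ⟨univ, univ_mem, fun h => absurd h hi⟩
    choose G hG hGs using this
    have hG' : (⋂ i ∈ Finset.range (K+1), G i) ∩ ball y ε ∈ 𝓝 y :=
      inter_mem ((biInter_finset_mem _).2 fun i _ => hG i) (ball_mem_nhds y hε)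
    obtain ⟨W, hW, hWG, hWc⟩ := exists_conn_nhd hX y hG'
    have hex : ∃ n, K0 < n ∧ BigS ε (f^[n] ⁻¹' W) := by
      obtain ⟨s, -, hs⟩ := mem_omega.1 hy (ball y ε) (ball_mem_nhds y hε) 0
      obtain ⟨t, ht, htW⟩ := mem_omega.1 hy W hW (s + K0 + 1)
      refine ⟨t - s, by omega, f^[s] x, ?_, b (t - s), ?_, ?_⟩
      · rw [mem_preimage, ← iterate_add_apply]
        have : t - s + s = t := by omega
        rwa [this]
      · rw [mem_preimage, hbi]; exact mem_of_mem_nhds hW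
      · have h1 := hcon (t - s) (by omega)
        have h2 := mem_ball.1 hs
        have h3 := dist_triangle_left (b (t-s)) y (f^[s] x)
        linarith
    classical
    have hsp := Nat.find_spec hex
    refine ⟨W, Nat.find hex, hW, hWc, fun z hz => (hWG hz).2, ?_, hsp.1, hsp.2, ?_⟩
    · by_contra hle
      refine hGs (Nat.find hex) hsp.1 ?_
      obtain ⟨u, hu, v, hv, huv⟩ := hsp.2
      have hsub : W ⊆ G (Nat.find hex) := fun z hz => by
        have := (hWG hz).1
        simp only [mem_iInter] at this
        exact this _ (Finset.mem_range.2 (by omega))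
      exact ⟨u, hsub hu, v, hsub hv, huv⟩
    · intro i hi him hbig
      exact Nat.find_min hex him ⟨hi, hbig⟩
  choose W m hWn hWc hWb hKm hK0m hbig hsmall using step
  let κ : ℕ → ℕ := fun n => Nat.rec 0 (fun _ k => m k + K0) n
  have hκ : ∀ n, κ (n+1) = m (κ n) + K0 := fun n => rfl
  have hmono : ∀ s t, s < t → m (κ s) + K0 < m (κ t) := by
    intro s t hst
    induction t with
    | zero => omega
    | succ t ih =>
      have h1 := hKm (κ (t+1))
      rw [hκ] at h1
      rcases Nat.lt_succ_iff_lt_or_eq.1 hst with h | rfl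
      · have := ih h
        rw [hκ]; omega
      · rw [hκ]; exact h1
  have := hN (Finset.range (N+1)) (fun s => f^[m (κ s)] ⁻¹' W (κ s))
    (fun s _ => iter_pre hf _ (hWc _)) (fun s _ => hbig _) (fun s _ t _ hst => by
      rw [Set.disjoint_left]
      intro u hu1 hu2
      have hlt := hmono s t hst
      have hpos := hK0m (κ s)
      have hns := hsmall (κ t) (m (κ t) - m (κ s)) (by omega) (by omega)
      have h1 : dist (f^[m (κ s)] u) (b (m (κ t) - m (κ s))) < ε := by
        by_contra hge
        refine hns ⟨f^[m (κ s)] u, ?_, b (m (κ t) - m (κ s)), ?_, not_lt.1 hge⟩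
        · rw [mem_preimage, ← iterate_add_apply]
          have : m (κ t) - m (κ s) + m (κ s) = m (κ t) := by omega
          rw [this]; exact hu2
        · rw [mem_preimage, hbi]; exact mem_of_mem_nhds (hWn _)
      have h2 := mem_ball.1 (hWb (κ s) hu1)
      have h3 := hcon (m (κ t) - m (κ s)) (by omega)
      have h4 := dist_triangle_left (b (m (κ t) - m (κ s))) y (f^[m (κ s)] u)
      linarith)
  simp at this

/-- offsets at which an orbit in the limit set is far from `A` -/
theorem offsets {X : Type*} [MetricSpace X] [CompactSpace X] [ConnectedSpace X]
    (hX : IsRegCurve X) {f : X → X} (hf : IsMonotoneMap f) {x y : X}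
    (hy : y ∈ omegaLimitSet f x) {G : Set X} (hG : G ∈ 𝓝 y) (N : ℕ) :
    ∃ w ∈ omegaLimitSet f x, ∃ I : Finset ℕ, I.card = N ∧ ∀ i ∈ I, f^[i] w ∈ G := by
  by_cases hper : ∃ r, 1 ≤ r ∧ f^[r] y = y
  · obtain ⟨r, hr, hry⟩ := hper
    refine ⟨y, hy, (Finset.range N).image (fun n => n * r), ?_, ?_⟩
    · rw [Finset.card_image_of_injective, Finset.card_range]
      intro p q hpq
      exact Nat.eq_of_mul_eq_mul_right (by omega) hpq
    · intro i hi
      obtain ⟨n, -, rfl⟩ := Finset.mem_image.1 hi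
      have : f^[n * r] y = y := by
        rw [mul_comm, iterate_mul]
        exact iterate_fixed hry n
      rw [this]; exact mem_of_mem_nhds hG
  · push Not at hper
    obtain ⟨𝒰, h𝒰, hlim⟩ := omega_ultra hy
    obtain ⟨b, hb1, hb2, hb3⟩ := exists_back hf.1 x (φ := id) (𝒰 := 𝒰) h𝒰
    have hb0 : b 0 = y := tendsto_nhds_unique (hb1 0) hlim
    have hne : ∀ i, 1 ≤ i → b i ≠ y := by
      intro i hi h
      have := back_iter hb2 i 0
      rw [zero_add, hb0, h] at this
      exact hper i hi this
    have hinf : {i | b i ∈ G}.Infinite := by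
      rw [Set.infinite_iff_exists_gt]
      intro K
      have hG' : G ∩ ⋂ i ∈ Finset.Icc 1 K, {b i}ᶜ ∈ 𝓝 y :=
        inter_mem hG ((biInter_finset_mem _).2 fun i hi =>
          isOpen_compl_singleton.mem_nhds (hne i (Finset.mem_Icc.1 hi).1).symm)
      obtain ⟨ε, hε, hball⟩ := Metric.mem_nhds_iff.1 hG'
      obtain ⟨i, hi, hd⟩ := back_rec hX hf hy hper hb2 hb0 hε
      have := hball (mem_ball.2 hd)
      refine ⟨i, this.1, ?_⟩
      by_contra hle
      have h2 := this.2
      simp only [mem_iInter] at h2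
      exact h2 i (Finset.mem_Icc.2 ⟨hi, by omega⟩) rfl
    obtain ⟨s, hs, hcard⟩ := hinf.exists_subset_card_eq N
    obtain ⟨K, hK⟩ := s.bddAbove
    refine ⟨b K, hb3 K, s.image (fun i => K - i), ?_, ?_⟩
    · rw [Finset.card_image_of_injOn, hcard]
      intro p hp q hq hpq
      have h1 := hK hp
      have h2 := hK hq
      simp only at hpq
      omega
    · intro i hi
      obtain ⟨j, hj, rfl⟩ := Finset.mem_image.1 hi
      have h1 := hK hj
      have := back_iter hb2 (K - j) j
      rw [show j + (K - j) = K by omega] at this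
      rw [this]; exact hs hj

theorem per_of_back {X : Type*} [MetricSpace X] [CompactSpace X] [ConnectedSpace X]
    (hX : IsRegCurve X) {f : X → X} (hf : IsMonotoneMap f) {x y p : X}
    {δ : X → ℝ} (hδc : Continuous δ) (hδ : ∀ u v, δ u ≤ δ v + dist u v)
    (hy : y ∈ omegaLimitSet f x) {c : ℝ} (hc : c < δ y)
    (hp : p ∈ omegaLimitSet f x) {b : ℕ → X} (hb : ∀ i, f (b (i+1)) = b i) (hb0 : b 0 = p)
    (hbc : ∀ i, δ (b i) ≤ c) : ∃ r, 1 ≤ r ∧ f^[r] p = p := by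
  by_contra! hper
  set ε := (δ y - c) / 2 with hεd
  have hε : 0 < ε := by rw [hεd]; linarith
  obtain ⟨N, hN⟩ := exists_bound hX hε
  obtain ⟨w, hw, I, hI, hIw⟩ := offsets hX hf hy (G := {z | c + ε < δ z})
    ((isOpen_lt continuous_const hδc).mem_nhds (by
      change c + ε < δ y
      rw [hεd]; linarith)) (N+1)
  obtain ⟨R, hR⟩ := I.bddAbove
  -- the neighbourhood V
  have hG : ∀ l, ∃ G ∈ 𝓝 p, 1 ≤ l → ∀ z ∈ G, f^[l] z ∉ G := by
    intro l
    by_cases hl : 1 ≤ l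
    · obtain ⟨G1, G2, h1, h2, hp1, hp2, hd⟩ := t2_separation (hper l hl)
      refine ⟨G2 ∩ f^[l] ⁻¹' G1, inter_mem (h2.mem_nhds hp2)
        (((hf.1.iterate l).continuousAt).preimage_mem_nhds (h1.mem_nhds hp1)), ?_⟩
      intro _ z hz hz2
      exact Set.disjoint_left.1 hd hz.2 hz2.1
    · exact ⟨univ, univ_mem, fun h => absurd h hl⟩
  choose G hGn hGd using hG
  obtain ⟨V, hV, hVG, hVc⟩ := exists_conn_nhd hX p
    ((biInter_finset_mem (Finset.range (R+1))).2 fun i _ => hGn i)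
  have hVd : ∀ l, 1 ≤ l → l ≤ R → ∀ z ∈ V, f^[l] z ∉ V := by
    intro l hl hlR z hz hz2
    have h1 := hVG hz
    have h2 := hVG hz2
    simp only [mem_iInter] at h1 h2
    exact hGd l hl z (h1 l (Finset.mem_range.2 (by omega))) (h2 l (Finset.mem_range.2 (by omega)))
  obtain ⟨s, -, hs⟩ := mem_omega.1 hw (⋂ i ∈ I, f^[i] ⁻¹' {z | c + ε < δ z})
    ((biInter_finset_mem _).2 fun i hi => (hf.1.iterate i).continuousAt.preimage_mem_nhds
      ((isOpen_lt continuous_const hδc).mem_nhds (hIw i hi))) 0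
  obtain ⟨t, ht, htV⟩ := mem_omega.1 hp V hV (s + R + 1)
  have hbi : ∀ i, f^[i] (b i) = p := fun i => by
    have := back_iter hb i 0
    rwa [zero_add, hb0] at this
  have := hN I (fun i => f^[t - s - i] ⁻¹' V) (fun i _ => iter_pre hf _ hVc)
    (fun i hi => by
      have hiR := hR hi
      refine ⟨f^[i] (f^[s] x), ?_, b (t - s - i), ?_, ?_⟩
      · rw [mem_preimage, ← iterate_add_apply, ← iterate_add_apply]
        rwa [show t - s - i + i + s = t by omega]
      · rw [mem_preimage, hbi]; exact mem_of_mem_nhds hV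
      · simp only [mem_iInter] at hs
        have h1 : c + ε < δ (f^[i] (f^[s] x)) := hs i hi
        have h2 := hbc (t - s - i)
        have h3 := hδ (f^[i] (f^[s] x)) (b (t - s - i))
        linarith)
    (fun i hi j hj hij => by
      have hiR := hR hi
      have hjR := hR hj
      exact (pre_disj hVd (show t - s - j < t - s - i by omega) (by omega)).symm)
  omega

theorem per_pts {X : Type*} [MetricSpace X] [CompactSpace X] [ConnectedSpace X]
    (hX : IsRegCurve X) {f : X → X} (hf : IsMonotoneMap f) {x y : X}
    {A : Set X} (hA : A ⊆ omegaLimitSet f x) (hAne : A.Nonempty) (hAi : f '' A ⊆ A)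
    (hy : y ∈ omegaLimitSet f x) {c : ℝ} (hc0 : 0 < c) (hc : c < infDist y A) :
    ∃ q ∈ omegaLimitSet f x, (∃ r, 1 ≤ r ∧ f^[r] q = q) ∧ infDist q A = c ∧
      ∀ n, infDist (f^[n] q) A ≤ c := by
  set δ : X → ℝ := fun z => infDist z A with hδd
  have hδc : Continuous δ := continuous_infDist_pt A
  have hδ : ∀ u v, δ u ≤ δ v + dist u v := fun u v => infDist_le_infDist_add_dist
  obtain ⟨a0, ha0⟩ := hAne
  have hex : ∀ k : ℕ, ∃ m, k ≤ m ∧ c ≤ δ (f^[m] x) ∧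
      ∀ i, 1 ≤ i → i ≤ k → δ (f^[m - i] x) < c := by
    intro k
    have hAit : ∀ i, f^[i] a0 ∈ A := by
      intro i
      induction i with
      | zero => exact ha0
      | succ i ih => rw [iterate_succ_apply']; exact hAi ⟨_, ih, rfl⟩
    obtain ⟨n, hn, hnG⟩ := mem_omega.1 (hA ha0)
      (⋂ i ∈ Finset.range (k+1), f^[i] ⁻¹' {z | δ z < c})
      ((biInter_finset_mem _).2 fun i hi => (hf.1.iterate i).continuousAt.preimage_mem_nhds
        ((isOpen_lt hδc continuous_const).mem_nhds (by
          change infDist (f^[i] a0) A < c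
          rw [infDist_zero_of_mem (hAit i)]; exact hc0))) k
    simp only [mem_iInter] at hnG
    have hnG' : ∀ i, i ≤ k → δ (f^[n + i] x) < c := by
      intro i hi
      have := hnG i (Finset.mem_range.2 (by omega))
      rw [mem_preimage, ← iterate_add_apply, add_comm] at this
      exact this
    have hE : ∃ m, n ≤ m ∧ c ≤ δ (f^[m] x) := by
      obtain ⟨m, hm, hmc⟩ := mem_omega.1 hy {z | c < δ z}
        ((isOpen_lt continuous_const hδc).mem_nhds hc) n
      exact ⟨m, hm, le_of_lt hmc⟩
    classical
    have hsp := Nat.find_spec hE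
    have hgt : n + k < Nat.find hE := by
      by_contra hle
      have := hnG' (Nat.find hE - n) (by omega)
      rw [show n + (Nat.find hE - n) = Nat.find hE by omega] at this
      linarith [hsp.2]
    refine ⟨Nat.find hE, by omega, hsp.2, ?_⟩
    intro i hi hik
    have := Nat.find_min hE (m := Nat.find hE - i) (by omega)
    by_contra hge
    exact this ⟨by omega, not_lt.1 hge⟩
  choose m hm1 hm2 hm3 using hex
  let 𝒰 : Ultrafilter ℕ := Ultrafilter.of atTop
  have h𝒰 : (𝒰 : Filter ℕ) ≤ atTop := Ultrafilter.of_le _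
  have hmt : Tendsto m 𝒰 atTop := (tendsto_atTop_mono hm1 tendsto_id).mono_left h𝒰
  obtain ⟨b, hb1, hb2, hb3⟩ := exists_back hf.1 x hmt
  have hb0 : c ≤ δ (b 0) :=
    ge_of_tendsto ((hδc.tendsto _).comp (hb1 0)) (Eventually.of_forall fun k => hm2 k)
  have hbi : ∀ i, 1 ≤ i → δ (b i) ≤ c := by
    intro i hi
    refine le_of_tendsto ((hδc.tendsto _).comp (hb1 i)) ?_
    filter_upwards [h𝒰 (eventually_ge_atTop i)] with k hk
    exact (hm3 k i hi hk).le
  have hper : ∀ i, 1 ≤ i → ∃ r, 1 ≤ r ∧ f^[r] (b i) = b i := by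
    intro i hi
    refine per_of_back hX hf hδc hδ hy hc (hb3 i) (b := fun j => b (i + j)) (fun j => hb2 (i + j))
      rfl (fun j => hbi _ (by omega))
  obtain ⟨r, hr, hr1⟩ := hper 1 le_rfl
  have hall : ∀ j, 1 ≤ j → f^[r] (b j) = b j := by
    intro j hj
    obtain ⟨r', hr', h⟩ := hper j hj
    have h1 := back_iter hb2 (j-1) 1
    rw [show 1 + (j - 1) = j by omega] at h1
    have h2 : f^[r' * (j-1)] (b j) = b j := by
      rw [iterate_mul]; exact iterate_fixed h _
    have h3 : f^[(r'-1)*(j-1)] (b 1) = b j := by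
      rw [← h1, ← iterate_add_apply]
      have : (r'-1)*(j-1) + (j-1) = r' * (j-1) := by
        obtain ⟨q, rfl⟩ := Nat.exists_eq_add_of_le hr'
        simp; ring
      rw [this, h2]
    rw [← h3, ← iterate_add_apply, add_comm, iterate_add_apply, hr1]
  have horb : ∀ n, δ (f^[n] (b 1)) ≤ c := by
    intro n
    have hle : n ≤ n * r := Nat.le_mul_of_pos_right _ (by omega)
    have h1 := back_iter hb2 (n * r - n) 1
    have h2 : f^[n] (b 1) = b (1 + (n * r - n)) := by
      conv_lhs => rw [← h1]
      rw [← iterate_add_apply, show n + (n * r - n) = n * r by omega, mul_comm, iterate_mul]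
      exact iterate_fixed (hall _ (by omega)) _
    rw [h2]; exact hbi _ (by omega)
  have hb01 : b 0 = f (b 1) := (hb2 0).symm
  refine ⟨b 0, hb3 0, ⟨r, hr, ?_⟩, ?_, ?_⟩
  · rw [hb01, ← iterate_succ_apply, iterate_succ_apply', hr1]
  · refine le_antisymm ?_ hb0
    rw [hb01]; exact horb 1
  · intro n
    rw [hb01, ← iterate_succ_apply]; exact horb _

theorem align {X : Type*} [TopologicalSpace X] {f : X → X} (hf : Continuous f) {x y : X}
    (hy : y ∈ omegaLimitSet f x) {r : ℕ} (hr : 1 ≤ r) :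
    ∃ u, ∀ G ∈ 𝓝 (f^[u] y), ∀ n, ∃ t, n ≤ t ∧ f^[r * t] x ∈ G := by
  obtain ⟨𝒰, h𝒰, hlim⟩ := omega_ultra hy
  have : ∃ k ∈ Finset.range r, ∀ᶠ t in (𝒰 : Filter ℕ), t % r = k := by
    have h1 : ∀ᶠ t in (𝒰 : Filter ℕ), ∃ k ∈ (Finset.range r : Set ℕ), t % r = k :=
      Eventually.of_forall fun t => ⟨_, by simpa using Nat.mod_lt _ (by omega), rfl⟩
    have h2 := (Ultrafilter.eventually_exists_mem_iff (Finset.finite_toSet (Finset.range r))).1 h1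
    simpa using h2
  obtain ⟨k, hk, hkt⟩ := this
  rw [Finset.mem_range] at hk
  refine ⟨r - k, fun G hG n => ?_⟩
  have h1 := (((hf.iterate (r-k)).tendsto y).comp hlim).eventually hG
  obtain ⟨t, ⟨ht1, ht2⟩, ht3⟩ := ((h1.and hkt).and (h𝒰 (eventually_ge_atTop (r * n)))).exists
  refine ⟨t / r + 1, ?_, ?_⟩
  · have := (Nat.le_div_iff_mul_le (show 0 < r by omega)).2 (show n * r ≤ t by rw [mul_comm]; exact ht3)
    omega
  · simp only [comp] at ht1
    rw [← iterate_add_apply] at ht1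
    have h3 := Nat.div_add_mod t r
    rw [ht2] at h3
    have : r * (t / r + 1) = r - k + t := by rw [mul_add]; omega
    rw [this]; exact ht1

theorem count_contra {N H r : ℕ} {s h : ℕ → ℕ} {BE BA : ℕ → ℕ → Prop}
    (hE : ∀ m, ∀ t : Finset ℕ, (∀ i ∈ t, i < 2*N+2 ∧ BE i m) → t.card ≤ N)
    (hA : ∀ m, ∀ t : Finset ℕ, (∀ i ∈ t, i < 2*N+2 ∧ BA i m) → t.card ≤ N)
    (hH : ∀ i < 2*N+2, h i ≤ H)
    (hs : ∀ i < 2*N+2, ∀ j < 2*N+2, s j ≤ r * h i)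
    (key : ∀ i < 2*N+2, ∀ j < 2*N+2, ∀ l, BE j (r*l) ∨ BA i (r*l + (r * h i - s j))) : False := by
  classical
  have gen : ∀ (B : ℕ → ℕ → Prop) (g : ℕ → ℕ) (L : ℕ),
      (∀ m, ∀ t : Finset ℕ, (∀ i ∈ t, i < 2*N+2 ∧ B i m) → t.card ≤ N) →
      ∑ j ∈ Finset.range (2*N+2), ((Finset.range L).filter (fun l => B j (g l))).card ≤ L * N := by
    intro B g L hB
    simp_rw [Finset.card_filter]
    rw [Finset.sum_comm]
    simp_rw [← Finset.card_filter]
    calc _ ≤ ∑ l ∈ Finset.range L, N := Finset.sum_le_sum fun l _ => hB (g l) _ (by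
          intro i hi; simpa using hi)
      _ = L * N := by simp
  set L := N * H + 1 with hL
  have h1 := gen BE (fun l => r * l) L hE
  have h2 : ∃ j ∈ Finset.range (2*N+2),
      2 * ((Finset.range L).filter (fun l => BE j (r * l))).card < L := by
    by_contra! hc
    have h3 := Finset.sum_le_sum hc
    rw [← Finset.mul_sum] at h3
    simp only [Finset.sum_const, Finset.card_range, smul_eq_mul] at h3
    nlinarith
  obtain ⟨j, hj, hj2⟩ := h2
  rw [Finset.mem_range] at hj
  set e := ((Finset.range L).filter (fun l => BE j (r * l))).card with he
  have h4 := gen BA (fun l => r * l - s j) (L + H) hA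
  have h5 : ∀ i ∈ Finset.range (2*N+2),
      L - e ≤ ((Finset.range (L+H)).filter (fun l => BA i (r * l - s j))).card := by
    intro i hi
    rw [Finset.mem_range] at hi
    have h6 : ((Finset.range L).filter (fun l => ¬ BE j (r * l))).card = L - e := by
      have := Finset.card_filter_add_card_filter_not (s := Finset.range L) (fun l => BE j (r * l))
      rw [Finset.card_range] at this
      omega
    rw [← h6]
    refine Finset.card_le_card_of_injOn (fun l => l + h i) ?_ ?_
    · intro l hl
      simp only [Finset.coe_filter, Finset.mem_range, mem_ofPred_eq] at hl ⊢
      refine ⟨by have := hH i hi; omega, ?_⟩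
      have h7 := (key i hi j hj l).resolve_left hl.2
      have h8 := hs i hi j hj
      rwa [show r * (l + h i) - s j = r * l + (r * h i - s j) by rw [mul_add]; omega]
    · intro l _ l' _ hll
      simpa using hll
  have h9 := Finset.sum_le_sum h5
  simp only [Finset.sum_const, Finset.card_range, smul_eq_mul] at h9
  have h10 : L + 1 ≤ 2 * (L - e) := by omega
  nlinarith

theorem sep_key {X : Type*} [MetricSpace X] {f : X → X} (hf : IsMonotoneMap f) {A V V' : Set X}
    {a : ℝ} (ha : 0 < a) (hV : IsPreconnected V) (hV' : IsPreconnected V') {m n : ℕ} {E P z : X}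
    (hE : f^[m] E ∈ V') (hP : f^[m+n] P ∈ V) (hdE : 2*a/3 ≤ infDist E A) (hdP : infDist P A ≤ a/4)
    (hz : z ∈ V') (hz2 : f^[n] z ∈ V) :
    BigS (a/8) (f^[m] ⁻¹' V') ∨ BigS (a/8) (f^[m+n] ⁻¹' V) := by
  by_contra hc
  rw [not_or] at hc
  obtain ⟨h1, h2⟩ := hc
  simp only [BigS, not_exists, not_and, not_le] at h1 h2
  have hU : IsPreconnected (f^[m] ⁻¹' (V' ∪ f^[n] ⁻¹' V)) :=
    iter_pre hf m (IsPreconnected.union z hz hz2 hV' (iter_pre hf n hV))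
  have hcd : Continuous (fun p : X => infDist p A) := continuous_infDist_pt A
  have := hU {p | a/2 < infDist p A} {p | infDist p A < a/2} (isOpen_lt continuous_const hcd)
    (isOpen_lt hcd continuous_const) ?_ ⟨E, Or.inl hE, ?_⟩ ⟨P, Or.inr ?_, ?_⟩
  · obtain ⟨p, _, hp1, hp2⟩ := this
    simp only [mem_ofPred_eq] at hp1 hp2
    exact lt_asymm hp1 hp2
  · rintro p (hp | hp)
    · left
      have h3 := h1 E hE p hp
      have h4 := infDist_le_infDist_add_dist (s := A) (x := E) (y := p)
      simp only [mem_ofPred_eq]; linarith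
    · right
      have h3 := h2 p (by
        change f^[n] (f^[m] p) ∈ V at hp
        rwa [← iterate_add_apply, add_comm] at hp) P hP
      have h4 := infDist_le_infDist_add_dist (s := A) (x := p) (y := P)
      simp only [mem_ofPred_eq]; linarith
  · simp only [mem_ofPred_eq]; linarith
  · change f^[n] (f^[m] P) ∈ V
    rwa [← iterate_add_apply, add_comm]
  · simp only [mem_ofPred_eq]; linarith

theorem sep_nhds {X : Type*} [MetricSpace X] [CompactSpace X] [ConnectedSpace X]
    (hX : IsRegCurve X) (J : ℕ) (p : ℕ → X) (hp : ∀ i < J, ∀ j < J, p i = p j → i = j) :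
    ∃ V : ℕ → Set X, (∀ i, V i ∈ 𝓝 (p i)) ∧ (∀ i, IsPreconnected (V i)) ∧
      ∀ i < J, ∀ j < J, i ≠ j → Disjoint (V i) (V j) := by
  obtain ⟨U, hU1, hU2⟩ := (Set.toFinite (p '' (Finset.range J : Set ℕ))).t2_separation
  choose V hV1 hV2 hV3 using fun i => exists_conn_nhd hX (p i) ((hU1 (p i)).2.mem_nhds (hU1 (p i)).1)
  refine ⟨V, hV1, hV3, fun i hi j hj hij => ?_⟩
  refine (hU2 ⟨i, by simpa using hi, rfl⟩ ⟨j, by simpa using hj, rfl⟩ ?_).mono (hV2 i) (hV2 j)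
  exact fun h => hij (hp i hi j hj h)

theorem bound_use {X : Type*} [MetricSpace X] {f : X → X} (hf : IsMonotoneMap f) {ε : ℝ} {N J : ℕ}
    (hN : ∀ (s : Finset ℕ) (S : ℕ → Set X), (∀ i ∈ s, IsPreconnected (S i)) →
      (∀ i ∈ s, BigS ε (S i)) → (∀ i ∈ s, ∀ j ∈ s, i < j → Disjoint (S i) (S j)) → s.card ≤ N)
    {V : ℕ → Set X} (hV : ∀ i, IsPreconnected (V i))
    (hd : ∀ i < J, ∀ j < J, i ≠ j → Disjoint (V i) (V j)) (m : ℕ) (t : Finset ℕ)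
    (ht : ∀ i ∈ t, i < J ∧ BigS ε (f^[m] ⁻¹' V i)) : t.card ≤ N :=
  hN t (fun i => f^[m] ⁻¹' V i) (fun i _ => iter_pre hf m (hV i)) (fun i hi => (ht i hi).2)
    (fun i hi j hj hij => (hd i (ht i hi).1 j (ht j hj).1 hij.ne).preimage _)

theorem final_contra {X : Type*} [MetricSpace X] [CompactSpace X] [ConnectedSpace X]
    (hX : IsRegCurve X) {f : X → X} (hf : IsMonotoneMap f) {x y : X} {A : Set X}
    (hA : A ⊆ omegaLimitSet f x) (hAne : A.Nonempty) (hAi : f '' A ⊆ A)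
    (hy : y ∈ omegaLimitSet f x) (ha : 0 < infDist y A) : False := by
  set a := infDist y A with hadef
  obtain ⟨N, hN⟩ := exists_bound hX (show 0 < a/8 by linarith)
  have hE := fun j : ℕ => per_pts hX hf hA hAne hAi hy (c := a - a/((j:ℝ)+3))
    (by
      have : a / ((j:ℝ)+3) ≤ a/3 := by gcongr; linarith [(Nat.cast_nonneg j : (0:ℝ) ≤ j)]
      linarith)
    (by have : 0 < a / ((j:ℝ)+3) := by positivity
        linarith)
  have hP := fun j : ℕ => per_pts hX hf hA hAne hAi hy (c := a/((j:ℝ)+5)) (by positivity)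
    (by
      have : a / ((j:ℝ)+5) ≤ a/5 := by gcongr; linarith [(Nat.cast_nonneg j : (0:ℝ) ≤ j)]
      linarith)
  choose E hE1 hE2 hE3 hE4 using hE
  choose P hP1 hP2 hP3 hP4 using hP
  choose rE hrE1 hrE2 using hE2
  choose rP hrP1 hrP2 using hP2
  set J := 2*N+2 with hJ
  obtain ⟨r, hr1, hrE, hrP⟩ : ∃ r, 1 ≤ r ∧ (∀ j < J, f^[r] (E j) = E j) ∧
      (∀ j < J, f^[r] (P j) = P j) := by
    have fx : ∀ (p : X) (u v : ℕ), f^[u] p = p → u ∣ v → f^[v] p = p := by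
      rintro p u _ h ⟨w, rfl⟩
      rw [iterate_mul]; exact iterate_fixed h _
    refine ⟨∏ j ∈ Finset.range J, rE j * rP j, Finset.prod_pos fun j _ =>
      Nat.mul_pos (hrE1 j) (hrP1 j), fun j hj => ?_, fun j hj => ?_⟩
    · exact fx _ _ _ (hrE2 j) ((Dvd.intro _ rfl).trans
        (Finset.dvd_prod_of_mem (fun j => rE j * rP j) (Finset.mem_range.2 hj)))
    · exact fx _ _ _ (hrP2 j) ((Dvd.intro_left _ rfl).trans
        (Finset.dvd_prod_of_mem (fun j => rE j * rP j) (Finset.mem_range.2 hj)))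
  choose u hu using fun j => align hf.1 (hP1 j) hr1
  set Q : ℕ → X := fun j => f^[u j] (P j) with hQ
  have hQr : ∀ j < J, f^[r] (Q j) = Q j := by
    intro j hj
    simp only [hQ]
    rw [← iterate_add_apply, add_comm, iterate_add_apply, hrP j hj]
  have hQle : ∀ j n, infDist (f^[n] (Q j)) A ≤ a/((j:ℝ)+5) := by
    intro j n
    simp only [hQ]
    rw [← iterate_add_apply]; exact hP4 j _
  have hQeq : ∀ j < J, ∃ n, infDist (f^[n] (Q j)) A = a/((j:ℝ)+5) := by
    intro j hj
    refine ⟨r * u j - u j, ?_⟩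
    simp only [hQ]
    have hle : u j ≤ r * u j := Nat.le_mul_of_pos_left _ (by omega)
    rw [← iterate_add_apply, show r * u j - u j + u j = r * u j by omega, iterate_mul,
      iterate_fixed (hrP j hj), hP3]
  have hQinj : ∀ i < J, ∀ j < J, Q i = Q j → i = j := by
    have half : ∀ i < J, ∀ j < J, Q i = Q j → j ≤ i := by
      intro i hi j hj h
      obtain ⟨n, hn⟩ := hQeq i hi
      rw [h] at hn
      have h1 := hQle j n
      rw [hn, div_le_div_iff_of_pos_left ha (by positivity) (by positivity)] at h1
      exact_mod_cast (by linarith : (j:ℝ) ≤ i)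
    exact fun i hi j hj h => le_antisymm (half j hj i hi h.symm) (half i hi j hj h)
  have hEinj : ∀ i < J, ∀ j < J, E i = E j → i = j := by
    intro i hi j hj h
    have h1 := hE3 i
    rw [h, hE3 j] at h1
    have h2 : a/((j:ℝ)+3) = a/((i:ℝ)+3) := by linarith
    rw [div_eq_div_iff (by positivity) (by positivity)] at h2
    have h3 := mul_left_cancel₀ ha.ne' h2
    exact_mod_cast (by linarith : (i:ℝ) = j)
  obtain ⟨V, hV1, hV2, hV3⟩ := sep_nhds hX J Q hQinj
  obtain ⟨W, hW1, hW2, hW3⟩ := sep_nhds hX J E hEinj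
  have hs : ∀ j, ∃ s, f^[s] x ∈ W j := fun j => by
    obtain ⟨s, _, h⟩ := mem_omega.1 (hE1 j) _ (hW1 j) 0
    exact ⟨s, h⟩
  choose s hs using hs
  choose h hh1 hh2 using fun i => hu i (V i) (hV1 i) (∑ j ∈ Finset.range J, s j)
  have fixmul : ∀ (p : X) (n : ℕ), f^[r] p = p → f^[r * n] p = p := by
    intro p n hp
    rw [iterate_mul]; exact iterate_fixed hp _
  have hsh : ∀ i < J, ∀ j < J, s j ≤ r * h i := by
    intro i _ j hj
    calc s j ≤ ∑ j ∈ Finset.range J, s j :=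
          Finset.single_le_sum (fun _ _ => Nat.zero_le _) (Finset.mem_range.2 hj)
      _ ≤ h i := hh1 i
      _ ≤ r * h i := Nat.le_mul_of_pos_left _ (by omega)
  refine count_contra (N := N) (H := ∑ i ∈ Finset.range J, h i) (r := r) (s := s) (h := h)
    (BE := fun j m => BigS (a/8) (f^[m] ⁻¹' W j)) (BA := fun j m => BigS (a/8) (f^[m] ⁻¹' V j))
    (fun m t ht => bound_use hf hN hW2 hW3 m t ht) (fun m t ht => bound_use hf hN hV2 hV3 m t ht)
    (fun i hi => Finset.single_le_sum (fun _ _ => Nat.zero_le _) (Finset.mem_range.2 hi))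
    hsh ?_
  intro i hi j hj l
  have hle := hsh i hi j hj
  refine sep_key (A := A) hf ha (hV2 i) (hW2 j) (E := E j) (P := f^[s j] (Q i)) (z := f^[s j] x)
    ?_ ?_ ?_ ?_ (hs j) ?_
  · rw [fixmul _ _ (hrE j hj)]; exact mem_of_mem_nhds (hW1 j)
  · rw [← iterate_add_apply, show r * l + (r * h i - s j) + s j = r * (l + h i) by
      rw [mul_add]; omega, fixmul _ _ (hQr i hi)]
    exact mem_of_mem_nhds (hV1 i)
  · rw [hE3]
    have : a / ((j:ℝ)+3) ≤ a/3 := by gcongr; linarith [(Nat.cast_nonneg j : (0:ℝ) ≤ j)]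
    linarith
  · refine (hQle i _).trans ?_
    gcongr; linarith [(Nat.cast_nonneg i : (0:ℝ) ≤ i)]
  · rw [← iterate_add_apply, show r * h i - s j + s j = r * h i by omega]
    exact hh2 i

theorem stmt_2 {X : Type*} [MetricSpace X] [CompactSpace X] [ConnectedSpace X]
    (hX : IsRegCurve X) (f : X → X) (hf : IsMonotoneMap f) (x : X) :
    IsMinimalSet f (omegaLimitSet f x) := by
  refine ⟨?_, isClosed_iInter fun n => isClosed_closure, ?_, ?_⟩
  · obtain ⟨y, hy⟩ := exists_clusterPt_of_compactSpace (map (fun k => f^[k] x) (atTop : Filter ℕ))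
    change MapClusterPt y atTop (fun k => f^[k] x) at hy
    refine ⟨y, mem_omega.2 fun G hG n => ?_⟩
    obtain ⟨m, hm, h⟩ := (frequently_atTop.1 (mapClusterPt_iff_frequently.1 hy G hG)) n
    exact ⟨m, hm, h⟩
  · rintro _ ⟨y, hy, rfl⟩
    exact omega_inv hf.1 hy
  · intro A hA hAne hAc hAi
    refine hA.antisymm fun y hy => ?_
    by_contra hyA
    exact final_contra hX hf hA hAne hAi hy ((hAc.notMem_iff_infDist_pos hAne).1 hyA)
end

section
/- Let X be a regular curve and f : X → X a monotone continuous map. Then Λ(f) = R(f) = AP(f), i.e. the union of all ω-limit sets of f equals the set of recurrent points of f, and both equal the set of almost periodic points of f. -/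
open Set Filter Metric Topology Function

lemma rc_precon {X : Type*} [TopologicalSpace X] {Y E : Set X} (hY : IsPreconnected Y)
    (hd : ∀ z ∈ Y, z ∉ frontier E) {a b : X} (ha : a ∈ Y) (haE : a ∈ E) (hb : b ∈ Y) : b ∈ E := by
  by_contra hbE
  have key : ∀ z ∈ Y, z ∈ interior E ∨ z ∈ (closure E)ᶜ := by
    intro z hz
    by_contra h
    push Not at h
    exact hd z hz ⟨by simpa using h.2, h.1⟩
  have h := hY (interior E) (closure E)ᶜ isOpen_interior isClosed_closure.isOpen_compl key
    ⟨a, ha, (key a ha).resolve_right (fun h => h (subset_closure haE))⟩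
    ⟨b, hb, (key b hb).resolve_left (fun h => hbE (interior_subset h))⟩
  obtain ⟨z, -, h1, h2⟩ := h
  exact h2 (subset_closure (interior_subset h1))

lemma rc_iter {X : Type*} [TopologicalSpace X] {f : X → X} (hf : IsMonotoneMap f) (n : ℕ) :
    IsMonotoneMap (f^[n]) := by
  induction n with
  | zero => exact ⟨continuous_id, fun C hC => by simpa using hC⟩
  | succ n ih =>
    refine ⟨hf.1.iterate _, fun C hC => ?_⟩
    rw [Function.iterate_succ, preimage_comp]
    exact hf.2 _ (ih.2 C hC)

lemma rc_lc {X : Type*} [MetricSpace X] [ConnectedSpace X] (hX : IsRegCurve X) :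
    LocallyConnectedSpace X := by
  rw [locallyConnectedSpace_iff_connected_subsets]
  intro x V hV
  obtain ⟨W, hW, hWc, hWV⟩ := exists_mem_nhds_isClosed_subset hV
  obtain ⟨U, hU, hxU, hUW, hF⟩ := hX x (interior W) isOpen_interior (mem_interior_iff_mem_nhds.2 hW)
  have hKV : closure U ⊆ V := (closure_minimal (hUW.trans interior_subset) hWc).trans hWV
  rcases (frontier U).eq_empty_or_nonempty with h0 | ⟨c, hc⟩
  · have h1 := frontier_eq_empty_iff.1 h0
    rcases h1 with h1 | h1
    · rw [h1] at hxU; exact absurd hxU (notMem_empty _)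
    · refine ⟨univ, univ_mem, isPreconnected_univ, ?_⟩
      rw [← h1]; exact subset_closure.trans hKV
  have meet : ∀ Q : Set (closure U), IsClopen Q → Q.Nonempty → ∃ a ∈ Q, a.1 ∈ frontier U := by
    intro Q hQ hne
    by_contra hno
    push Not at hno
    have hcl : IsClosed (Subtype.val '' Q) :=
      isClosed_closure.isClosedEmbedding_subtypeVal.isClosedMap _ hQ.1
    obtain ⟨O, hO, hOQ⟩ := isOpen_induced_iff.1 hQ.2
    have hop : Subtype.val '' Q = U ∩ O := by
      ext z
      constructor
      · rintro ⟨a, ha, rfl⟩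
        refine ⟨?_, by rw [← hOQ] at ha; exact ha⟩
        by_contra hn
        exact hno a ha (by rw [hU.frontier_eq]; exact ⟨a.2, hn⟩)
      · rintro ⟨h1, h2⟩
        exact ⟨⟨z, subset_closure h1⟩, by rw [← hOQ]; exact h2, rfl⟩
    have hclo : IsClopen (Subtype.val '' Q) := ⟨hcl, by rw [hop]; exact hU.inter hO⟩
    have : Subtype.val '' Q = univ := (isClopen_iff.1 hclo).resolve_left (hne.image _).ne_empty
    have hcc : c ∈ Subtype.val '' Q := by rw [this]; trivial
    obtain ⟨a, ha, hac⟩ := hcc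
    exact hno a ha (hac ▸ hc)
  let x' : closure U := ⟨x, subset_closure hxU⟩
  let F' : Set (closure U) := Subtype.val ⁻¹' frontier U
  have hF' : F'.Finite := hF.preimage Subtype.val_injective.injOn
  have hex : ∃ n : ℕ, ∃ Q : Set (closure U), IsClopen Q ∧ x' ∈ Q ∧ (Q ∩ F').ncard = n :=
    ⟨_, univ, isClopen_univ, trivial, rfl⟩
  classical
  obtain ⟨Q, hQ, hxQ, hn⟩ := Nat.find_spec hex
  have hmin : ∀ Q' : Set (closure U), IsClopen Q' → x' ∈ Q' → (Q ∩ F').ncard ≤ (Q' ∩ F').ncard := by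
    intro Q' h1 h2
    rw [hn]
    exact Nat.find_min' hex ⟨Q', h1, h2, rfl⟩
  have aux : ∀ t t' : Set (closure U), IsClosed t → IsClosed t' → Q ⊆ t ∪ t' → (Q ∩ t').Nonempty →
      x' ∈ t → (Q ∩ (t ∩ t')).Nonempty := by
    intro t t' ht ht' hsub hne hx
    by_contra hemp
    rw [not_nonempty_iff_eq_empty] at hemp
    have e1 : Q ∩ t = Q ∩ t'ᶜ := by
      ext z; constructor
      · rintro ⟨h1, h2⟩
        refine ⟨h1, fun h3 => ?_⟩
        have : z ∈ Q ∩ (t ∩ t') := ⟨h1, h2, h3⟩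
        rw [hemp] at this; exact this
      · rintro ⟨h1, h2⟩
        exact ⟨h1, (hsub h1).resolve_right h2⟩
    have e2 : Q ∩ t' = Q ∩ tᶜ := by
      ext z; constructor
      · rintro ⟨h1, h2⟩
        refine ⟨h1, fun h3 => ?_⟩
        have : z ∈ Q ∩ (t ∩ t') := ⟨h1, h3, h2⟩
        rw [hemp] at this; exact this
      · rintro ⟨h1, h2⟩
        exact ⟨h1, (hsub h1).resolve_left h2⟩
    have c1 : IsClopen (Q ∩ t) := ⟨hQ.1.inter ht, by rw [e1]; exact hQ.2.inter ht'.isOpen_compl⟩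
    have c2 : IsClopen (Q ∩ t') := ⟨hQ.1.inter ht', by rw [e2]; exact hQ.2.inter ht.isOpen_compl⟩
    obtain ⟨a, ha, haF⟩ := meet _ c2 hne
    have h1 := hmin _ c1 ⟨hxQ, hx⟩
    have h2 : (Q ∩ t ∩ F').ncard < (Q ∩ F').ncard := by
      refine ncard_lt_ncard ⟨fun z hz => ⟨hz.1.1, hz.2⟩, fun hh => ?_⟩ (hF'.subset inter_subset_right)
      have h3 := hh (show a ∈ Q ∩ F' from ⟨ha.1, haF⟩)
      have : a ∈ Q ∩ (t ∩ t') := ⟨ha.1, h3.1.2, ha.2⟩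
      rw [hemp] at this; exact this
    omega
  have hpre : IsPreconnected Q := by
    rw [isPreconnected_closed_iff]
    intro t t' ht ht' hsub hne hne'
    rcases hsub hxQ with h | h
    · exact aux t t' ht ht' hsub hne' h
    · rw [inter_comm t t']
      exact aux t' t ht' ht (by rwa [union_comm]) hne h
  obtain ⟨O, hO, hOQ⟩ := isOpen_induced_iff.1 hQ.2
  refine ⟨Subtype.val '' Q, ?_, hpre.image _ continuous_subtype_val.continuousOn, ?_⟩
  · refine mem_of_superset ((hU.inter hO).mem_nhds ⟨hxU, by rw [← hOQ] at hxQ; exact hxQ⟩) ?_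
    rintro z ⟨h1, h2⟩
    exact ⟨⟨z, subset_closure h1⟩, by rw [← hOQ]; exact h2, rfl⟩
  · rintro _ ⟨a, -, rfl⟩
    exact hKV a.2

lemma rc_ramsey {κ : Type*} [Finite κ] (c : ℕ → ℕ → κ) (J : ℕ → Prop)
    (hJ : ∀ N, ∃ j, N ≤ j ∧ J j) (l0 : ℕ) :
    ∃ n m q, J n ∧ J m ∧ J q ∧ n + l0 ≤ m ∧ m + l0 ≤ q ∧ c n q = c n m ∧ c m q = c n m := by
  have hfr : ∃ᶠ j in atTop, J j := by
    rw [frequently_atTop]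
    intro N
    obtain ⟨j, h1, h2⟩ := hJ N
    exact ⟨j, h1, h2⟩
  have hne : NeBot (atTop ⊓ 𝓟 {j : ℕ | J j}) := frequently_mem_iff_neBot.1 hfr
  obtain ⟨𝒰, h𝒰⟩ := Ultrafilter.exists_le (atTop ⊓ 𝓟 {j : ℕ | J j})
  have col : ∀ d : ℕ → κ, ∃ k, ∀ᶠ m in (𝒰 : Filter ℕ), d m = k := by
    intro d
    obtain ⟨k, hk⟩ := Ultrafilter.eq_pure_of_finite (𝒰.map d)
    refine ⟨k, ?_⟩
    have : {k} ∈ 𝒰.map d := by rw [hk]; exact Ultrafilter.mem_pure.2 rfl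
    exact this
  choose k hk using fun n => col (c n)
  obtain ⟨k0, hk0⟩ := col k
  have hat : ∀ N : ℕ, ∀ᶠ m in (𝒰 : Filter ℕ), N ≤ m := fun N =>
    (h𝒰.trans inf_le_left) (eventually_ge_atTop N)
  have hJU : ∀ᶠ m in (𝒰 : Filter ℕ), J m :=
    (h𝒰.trans inf_le_right) (mem_principal_self _)
  obtain ⟨n, hn1, hn2⟩ := (hk0.and hJU).exists
  obtain ⟨m, ⟨⟨hm1, hm2⟩, hm3⟩, hm4⟩ := (((hk n).and hk0).and (hJU.and (hat (n + l0)))|>.mono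
    (fun a ha => show ((c n a = k n ∧ k a = k0) ∧ J a) ∧ n + l0 ≤ a from ⟨⟨ha.1, ha.2.1⟩, ha.2.2⟩)).exists
  obtain ⟨q, ⟨hq1, hq2⟩, hq3, hq4⟩ := (((hk n).and (hk m)).and (hJU.and (hat (m + l0)))).exists
  exact ⟨n, m, q, hn2, hm3, hq3, hm4, hq4, by rw [hq1, hm1], by rw [hq2, hm2, hm1, hn1]⟩

def rcFib {X : Type*} (f : X → X) (p : ℕ × X) : Set X := {z | f^[p.1] z = p.2}

def rcSh {X : Type*} (n : ℕ) (p : ℕ × X) : ℕ × X := (p.1 + n, p.2)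

def rcFree {X : Type*} (f : X → X) (w : X) (G : Set X) : Prop :=
  ∃ C : Set X, C.Finite ∧ MapsTo f C C ∧ w ∉ C ∧ ∃ M : ℕ, G ⊆ f^[M] ⁻¹' C

def rcCut {X : Type*} [TopologicalSpace X] (f : X → X) (w x : X) (V : Set X)
    (S : Finset (ℕ × X)) : Prop :=
  IsOpen V ∧ w ∈ V ∧ (∀ N, ∃ j, N ≤ j ∧ f^[j] x ∉ V) ∧ (∀ p ∈ S, p.2 ≠ w) ∧
    ∃ G, rcFree f w G ∧ ∀ z, z ∈ closure V → z ∉ V → (∃ p ∈ S, z ∈ rcFib f p) ∨ z ∈ G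

def rcMin {X : Type*} [TopologicalSpace X] (f : X → X) (w x : X) (V : Set X)
    (S : Finset (ℕ × X)) : Prop :=
  rcCut f w x V S ∧ ∀ V' S', rcCut f w x V' S' → S.card ≤ S'.card

lemma rc_fib_sh {X : Type*} {f : X → X} {n : ℕ} {p : ℕ × X} {z : X} :
    z ∈ rcFib f (rcSh n p) ↔ f^[n] z ∈ rcFib f p := by
  simp only [rcFib, rcSh, mem_ofPred_eq, iterate_add_apply]

lemma rc_fix {X : Type*} {f : X → X} {w : X} (hw : f w = w) (n : ℕ) : f^[n] w = w :=
  iterate_fixed hw n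

lemma rc_inv {X : Type*} {f : X → X} {C : Set X} (h : MapsTo f C C) (n : ℕ) {z : X}
    (hz : z ∈ C) : f^[n] z ∈ C := h.iterate n hz

lemma rc_free_empty {X : Type*} (f : X → X) (w : X) : rcFree f w ∅ :=
  ⟨∅, finite_empty, mapsTo_empty _ _, notMem_empty _, 0, empty_subset _⟩

lemma rc_free_union {X : Type*} {f : X → X} {w : X} {G H : Set X} (hG : rcFree f w G)
    (hH : rcFree f w H) : rcFree f w (G ∪ H) := by
  obtain ⟨C, hC, hCi, hCw, M, hM⟩ := hG
  obtain ⟨D, hD, hDi, hDw, N, hN⟩ := hH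
  refine ⟨C ∪ D, hC.union hD, hCi.union_union hDi, by simp [hCw, hDw], M + N, ?_⟩
  rintro z (hz | hz)
  · left
    rw [add_comm, iterate_add_apply]
    exact rc_inv hCi _ (hM hz)
  · right
    rw [iterate_add_apply]
    exact rc_inv hDi _ (hN hz)

lemma rc_free_all {X : Type*} {f : X → X} {w : X} {G : Set X} (hG : rcFree f w G) (E : ℕ) :
    ∃ G', rcFree f w G' ∧ ∀ e ≤ E, ∀ z, f^[e] z ∈ G → z ∈ G' := by
  obtain ⟨C, hC, hCi, hCw, M, hM⟩ := hG
  refine ⟨f^[M + E] ⁻¹' C, ⟨C, hC, hCi, hCw, M + E, Subset.rfl⟩, ?_⟩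
  intro e he z hz
  obtain ⟨d, rfl⟩ := Nat.exists_eq_add_of_le he
  have h1 : f^[M] (f^[e] z) ∈ C := hM hz
  have h2 := rc_inv hCi d h1
  rw [← iterate_add_apply, ← iterate_add_apply] at h2
  rw [mem_preimage]
  convert h2 using 2
  ring_nf

lemma rc_fib_precon {X : Type*} [TopologicalSpace X] {f : X → X} (hf : IsMonotoneMap f)
    (p : ℕ × X) : IsPreconnected (rcFib f p) := by
  have := (rc_iter hf p.1).2 {p.2} isPreconnected_singleton
  exact this

lemma rc_Y {X : Type*} [TopologicalSpace X] [T1Space X] [LocallyConnectedSpace X] {f : X → X}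
    (hf : IsMonotoneMap f) {w x : X} (hw : f w = w)
    (hom : ∀ U : Set X, IsOpen U → w ∈ U → ∀ N, ∃ j, N ≤ j ∧ f^[j] x ∈ U)
    {G : Set X} (hG : rcFree f w G) :
    ∃ Y : Set X, IsPreconnected Y ∧ w ∈ Y ∧ (∀ j, f^[j] x ∈ Y) ∧ ∀ z ∈ Y, z ∉ G := by
  obtain ⟨C, hC, hCi, hCw, M, hM⟩ := hG
  set P : Set X := (f^[M] ⁻¹' C)ᶜ with hP
  have hPo : IsOpen P := (hC.isClosed.preimage (hf.1.iterate M)).isOpen_compl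
  have hwP : w ∈ P := by
    intro h
    rw [mem_preimage, rc_fix hw] at h
    exact hCw h
  set O := connectedComponentIn P w with hO
  have hOo : IsOpen O := hPo.connectedComponentIn
  have hOP : O ⊆ P := connectedComponentIn_subset _ _
  have hwO : w ∈ O := mem_connectedComponentIn hwP
  have hback : ∀ z, f z ∈ O → z ∈ O := by
    have h1 : IsPreconnected (f ⁻¹' O) := hf.2 _ isPreconnected_connectedComponentIn
    have h2 : f ⁻¹' O ⊆ O := by
      refine h1.subset_connectedComponentIn (by simpa [hw] using hwO) ?_
      intro z hz hz'
      refine hOP hz ?_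
      rw [mem_preimage, ← iterate_succ_apply, iterate_succ_apply']
      exact hCi hz'
    exact fun z hz => h2 hz
  have hback' : ∀ n z, f^[n] z ∈ O → z ∈ O := by
    intro n
    induction n with
    | zero => intro z hz; exact hz
    | succ n ih =>
      intro z hz
      rw [iterate_succ_apply] at hz
      exact hback z (ih _ hz)
  refine ⟨O, isPreconnected_connectedComponentIn, hwO, fun j => ?_, fun z hz hzG => hOP hz (hM hzG)⟩
  obtain ⟨i, hi, hiO⟩ := hom O hOo hwO j
  obtain ⟨d, rfl⟩ := Nat.exists_eq_add_of_le hi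
  rw [add_comm, iterate_add_apply] at hiO
  exact hback' d _ hiO

lemma rc_sep {X : Type*} [TopologicalSpace X] [T1Space X] [LocallyConnectedSpace X] {f : X → X}
    (hf : IsMonotoneMap f) {w x : X} (hw : f w = w)
    (hom : ∀ U : Set X, IsOpen U → w ∈ U → ∀ N, ∃ j, N ≤ j ∧ f^[j] x ∈ U)
    {G E : Set X} (hG : rcFree f w G) (hE : ∀ z ∈ frontier E, z ∈ G) (j : ℕ) :
    f^[j] x ∈ E ↔ w ∈ E := by
  obtain ⟨Y, hY, hwY, hxY, hYG⟩ := rc_Y hf hw hom hG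
  have hd : ∀ z ∈ Y, z ∉ frontier E := fun z hz hz' => hYG z hz (hE z hz')
  exact ⟨fun h => rc_precon hY hd (hxY j) h hwY, fun h => rc_precon hY hd hwY h (hxY j)⟩

lemma rc_noinv {X : Type*} [TopologicalSpace X] {f : X → X} {w x : X} {V : Set X}
    {S : Finset (ℕ × X)} (hm : rcMin f w x V S) {p : ℕ × X} (hp : p ∈ S) {D : Set X}
    (hD : D.Finite) (hDi : MapsTo f D D) (hDw : w ∉ D) (r : ℕ) (hr : f^[r] p.2 ∈ D) : False := by
  classical
  obtain ⟨⟨hVo, hwV, hinf, hS, G, hG, hcov⟩, hmin⟩ := hm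
  have hH : rcFree f w (f^[r + p.1] ⁻¹' D) := ⟨D, hD, hDi, hDw, _, Subset.rfl⟩
  have hcut : rcCut f w x V (S.erase p) := by
    refine ⟨hVo, hwV, hinf, fun q hq => hS q (Finset.mem_of_mem_erase hq), _,
      rc_free_union hG hH, fun z hz hz' => ?_⟩
    rcases hcov z hz hz' with ⟨q, hq, hzq⟩ | h
    · by_cases hqp : q = p
      · right; right
        subst hqp
        rw [mem_preimage, iterate_add_apply]
        have : f^[q.1] z = q.2 := hzq
        rwa [this]
      · left; exact ⟨q, Finset.mem_erase.2 ⟨hqp, hq⟩, hzq⟩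
    · right; left; exact h
  have := hmin _ _ hcut
  have := Finset.card_erase_lt_of_mem hp
  omega

lemma rc_free_disj {X : Type*} [TopologicalSpace X] {f : X → X} {w x : X} {V : Set X}
    {S : Finset (ℕ × X)} (hm : rcMin f w x V S) {p : ℕ × X} (hp : p ∈ S) {G : Set X}
    (hG : rcFree f w G) {n : ℕ} {z : X} (hz : z ∈ rcFib f (rcSh n p)) : z ∉ G := by
  intro hzG
  obtain ⟨C, hC, hCi, hCw, M, hM⟩ := hG
  refine rc_noinv hm hp hC hCi hCw M ?_
  have h1 : f^[p.1 + n] z = p.2 := hz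
  rw [← h1, ← iterate_add_apply, add_comm, iterate_add_apply]
  exact rc_inv hCi _ (hM hzG)

lemma rc_nonper {X : Type*} [TopologicalSpace X] {f : X → X} {w x : X} {V : Set X}
    {S : Finset (ℕ × X)} (hm : rcMin f w x V S) (hw : f w = w) {p : ℕ × X} (hp : p ∈ S) {e : ℕ}
    (he : f^[e] p.2 = p.2) : e = 0 := by
  by_contra h0
  refine rc_noinv hm hp (D := (fun i => f^[i] p.2) '' Set.Iio e) ((finite_Iio e).image _) ?_ ?_ 0
    ⟨0, by simp; omega, rfl⟩
  · rintro _ ⟨i, hi, rfl⟩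
    have hi' : i < e := hi
    by_cases h : i + 1 < e
    · exact ⟨i + 1, h, by simp only [iterate_succ_apply']⟩
    · have : i + 1 = e := by omega
      refine ⟨0, by simp; omega, ?_⟩
      simp only [iterate_zero, id]
      rw [← iterate_succ_apply' f, Nat.succ_eq_add_one, this, he]
  · rintro ⟨i, hi, hiw⟩
    have hi' : i < e := hi
    refine hm.1.2.2.2.1 p hp ?_
    have : e = (e - i) + i := by omega
    rw [this, iterate_add_apply] at he
    simp only at hiw
    rw [hiw, rc_fix hw] at he
    exact he.symm

lemma rc_l0 {X : Type*} [TopologicalSpace X] {f : X → X} {w x : X} {V : Set X}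
    {S : Finset (ℕ × X)} (hm : rcMin f w x V S) (hw : f w = w) :
    ∃ l0, 1 ≤ l0 ∧ ∀ l, l0 ≤ l → ∀ p ∈ S, ∀ p' ∈ S, ∀ z, z ∈ rcFib f p →
      z ∉ rcFib f (rcSh l p') := by
  have hb : ∀ p p' : ℕ × X, ∃ b, p' ∈ S → ∀ l, b ≤ l → ∀ z, z ∈ rcFib f p →
      z ∉ rcFib f (rcSh l p') := by
    intro p p'
    have key : ∀ l, p.1 ≤ l → ∀ z, z ∈ rcFib f p → z ∈ rcFib f (rcSh l p') →
        f^[p'.1 + l - p.1] p.2 = p'.2 := by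
      intro l hl z h1 h2
      have h1' : f^[p.1] z = p.2 := h1
      have h2' : f^[p'.1 + l] z = p'.2 := h2
      have h3 : p'.1 + l - p.1 + p.1 = p'.1 + l := by omega
      rw [← h1', ← iterate_add_apply, h3, h2']
    by_cases h : ∃ e, f^[e] p.2 = p'.2
    · obtain ⟨e, he⟩ := h
      refine ⟨p.1 + e + 1, fun hp' l hl z h1 h2 => ?_⟩
      have h3 := key l (by omega) z h1 h2
      have h4 : p'.1 + l - p.1 = (p'.1 + l - p.1 - e) + e := by omega
      rw [h4, iterate_add_apply, he] at h3
      have := rc_nonper hm hw hp' h3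
      omega
    · refine ⟨p.1, fun hp' l hl z h1 h2 => h ⟨_, key l hl z h1 h2⟩⟩
  choose b hb using hb
  refine ⟨(S ×ˢ S).sup (fun t => b t.1 t.2) + 1, by omega, fun l hl p hp p' hp' z h1 => ?_⟩
  refine hb p p' hp' l ?_ z h1
  have : b p p' ≤ (S ×ˢ S).sup (fun t => b t.1 t.2) :=
    Finset.le_sup (f := fun t : (ℕ × X) × (ℕ × X) => b t.1 t.2) (b := (p, p'))
      (Finset.mem_product.2 ⟨hp, hp'⟩)
  omega

lemma rc_side {X : Type*} [TopologicalSpace X] {f : X → X} (hf : IsMonotoneMap f)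
    {w x : X} {V : Set X}
    {S : Finset (ℕ × X)} (hm : rcMin f w x V S) {l0 : ℕ}
    (hl0 : ∀ l, l0 ≤ l → ∀ p ∈ S, ∀ p' ∈ S, ∀ z, z ∈ rcFib f p → z ∉ rcFib f (rcSh l p'))
    {n m : ℕ} (hnm : n + l0 ≤ m ∨ m + l0 ≤ n) {p : ℕ × X} (hp : p ∈ S) {z : X}
    (hz : z ∈ rcFib f (rcSh n p)) (hzc : f^[m] z ∈ closure V) :
    ∀ z' ∈ rcFib f (rcSh n p), f^[m] z' ∈ V := by
  have hm' := hm
  obtain ⟨⟨hVo, hwV, hinf, hS, G, hG, hcov⟩, hmin⟩ := hm'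
  have hd : ∀ u ∈ rcFib f (rcSh n p), f^[m] u ∈ closure V → f^[m] u ∈ V := by
    intro u hu huc
    by_contra hun
    rcases hcov _ huc hun with ⟨p', hp', h⟩ | h
    · rw [rc_fib_sh] at hu
      rcases hnm with hnm | hnm
      · obtain ⟨d, rfl⟩ := Nat.exists_eq_add_of_le hnm
        refine hl0 (l0 + d) (by omega) p hp p' hp' _ hu ?_
        rw [rc_fib_sh, ← iterate_add_apply]
        convert h using 2
        ring_nf
      · obtain ⟨d, rfl⟩ := Nat.exists_eq_add_of_le hnm
        refine hl0 (l0 + d) (by omega) p' hp' p hp _ h ?_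
        rw [rc_fib_sh, ← iterate_add_apply]
        convert hu using 2
        ring_nf
    · obtain ⟨G', hG', hGG⟩ := rc_free_all hG m
      exact rc_free_disj hm hp hG' hu (hGG m le_rfl u h)
  intro z' hz'
  have hfr : ∀ u ∈ rcFib f (rcSh n p), u ∉ frontier (f^[m] ⁻¹' V) := by
    intro u hu huf
    have h1 := (hf.1.iterate m).frontier_preimage_subset V huf
    rw [hVo.frontier_eq] at h1
    exact h1.2 (hd u hu h1.1)
  exact rc_precon (E := f^[m] ⁻¹' V) (rc_fib_precon hf _) hfr hz (hd z hz hzc) hz'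

def rcSub {X : Type*} (f : X → X) (V : Set X) (p : ℕ × X) (n m : ℕ) : Prop :=
  ∀ z ∈ rcFib f (rcSh n p), f^[m] z ∈ V

lemma rc_caseA {X : Type*} [TopologicalSpace X] [T1Space X] [LocallyConnectedSpace X] {f : X → X}
    (hf : IsMonotoneMap f) {w x : X} (hw : f w = w)
    (hom : ∀ U : Set X, IsOpen U → w ∈ U → ∀ N, ∃ j, N ≤ j ∧ f^[j] x ∈ U)
    {V : Set X} {S : Finset (ℕ × X)} (hm : rcMin f w x V S) {n m q : ℕ}
    (hnm : n ≤ m) (hmq : m ≤ q) (hn : f^[n] x ∉ V) (hmx : f^[m] x ∉ V)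
    (side : ∀ a b, (a = n ∨ a = m ∨ a = q) → (b = n ∨ b = m ∨ b = q) → a ≠ b → ∀ p ∈ S, ∀ z,
      z ∈ rcFib f (rcSh a p) → f^[b] z ∈ closure V → rcSub f V p a b)
    (hnm' : n ≠ m) (hmq' : m ≠ q) (hnq' : n ≠ q)
    (hα : ∀ p ∈ S, rcSub f V p n q → rcSub f V p n m)
    (hα' : ∀ p ∈ S, rcSub f V p m q → rcSub f V p n m)
    (hβ : ∀ p ∈ S, rcSub f V p q n → rcSub f V p q m)
    (hΔ : ∃ N, ∀ j, N ≤ j → f^[j] x ∉ V → f^[j + (m - n)] x ∈ V)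
    (hΔ' : ∃ N, ∀ j, N ≤ j → f^[j] x ∉ V → f^[j + (q - m)] x ∈ V) : False := by
  classical
  have hm0 := hm
  obtain ⟨⟨hVo, hwV, hinf, hS, G, hG, hcov⟩, hmin⟩ := hm0
  obtain ⟨G', hG', hGG⟩ := rc_free_all hG q
  have hcl : ∀ n, closure (f^[n] ⁻¹' V) ⊆ f^[n] ⁻¹' closure V := fun n =>
    (hf.1.iterate n).closure_preimage_subset V
  have hcl' : ∀ n, IsClosed (f^[n] ⁻¹' closure V) := fun n =>
    isClosed_closure.preimage (hf.1.iterate n)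
  have hop : ∀ n, IsOpen (f^[n] ⁻¹' V) := fun n => hVo.preimage (hf.1.iterate n)
  have hcc : ∀ n, closure ((f^[n] ⁻¹' closure V)ᶜ) ⊆ (f^[n] ⁻¹' V)ᶜ := fun n =>
    closure_minimal (compl_subset_compl.2 (preimage_mono subset_closure)) (hop n).isClosed_compl
  have hcov' : ∀ e z, e ≤ q → f^[e] z ∈ closure V → f^[e] z ∉ V →
      (∃ p ∈ S, z ∈ rcFib f (rcSh e p)) ∨ z ∈ G' := by
    intro e z he h1 h2
    rcases hcov _ h1 h2 with ⟨p, hp, h⟩ | h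
    · exact Or.inl ⟨p, hp, rc_fib_sh.2 h⟩
    · exact Or.inr (hGG e he z h)
  have hcut : rcCut f w x (f^[m] ⁻¹' V ∪ ((f^[n] ⁻¹' closure V)ᶜ ∪ (f^[q] ⁻¹' closure V)ᶜ))
      ((S.filter (fun p => rcSub f V p n m ∧ rcSub f V p m n)).image (rcSh m)) := by
    refine ⟨(hop m).union ((hcl' n).isOpen_compl.union (hcl' q).isOpen_compl), ?_, ?_, ?_, G', hG', ?_⟩
    · left; rw [mem_preimage, rc_fix hw]; exact hwV
    · intro N
      obtain ⟨N1, h1⟩ := hΔ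
      obtain ⟨N2, h2⟩ := hΔ'
      obtain ⟨j, hj, hjV⟩ := hinf (N + m + N1 + N2)
      refine ⟨j - m, by omega, ?_⟩
      rintro (h | h | h)
      · rw [mem_preimage, ← iterate_add_apply, show m + (j - m) = j by omega] at h
        exact hjV h
      · refine h (subset_closure ?_)
        rw [← iterate_add_apply]
        by_contra hh
        have := h1 (n + (j - m)) (by omega) hh
        rw [show n + (j - m) + (m - n) = j by omega] at this
        exact hjV this
      · refine h (subset_closure ?_)
        rw [← iterate_add_apply]
        have := h2 j (by omega) hjV
        rwa [show q + (j - m) = j + (q - m) by omega]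
    · intro p hp
      obtain ⟨p', hp', rfl⟩ := Finset.mem_image.1 hp
      exact hS p' (Finset.mem_filter.1 hp').1
    · intro z hz hzW
      simp only [mem_union, not_or, mem_compl_iff, not_not] at hzW
      obtain ⟨zm, zn, zq⟩ := hzW
      rw [closure_union, closure_union] at hz
      have hz' : f^[m] z ∈ closure V ∨ f^[n] z ∉ V ∨ f^[q] z ∉ V := by
        rcases hz with h | h | h
        · exact Or.inl (hcl m h)
        · exact Or.inr (Or.inl (hcc n h))
        · exact Or.inr (Or.inr (hcc q h))
      rcases hz' with h | h | h
      · rcases hcov' m z (by omega) h zm with ⟨p, hp, hzp⟩ | h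
        · left
          refine ⟨rcSh m p, Finset.mem_image_of_mem _ (Finset.mem_filter.2 ⟨hp, ?_, ?_⟩), hzp⟩
          · exact hα' p hp (side m q (by simp) (by simp) hmq' p hp z hzp zq)
          · exact side m n (by simp) (by simp) hnm'.symm p hp z hzp zn
        · exact Or.inr h
      · rcases hcov' n z (by omega) zn h with ⟨p, hp, hzp⟩ | h
        · exact absurd (hα p hp (side n q (by simp) (by simp) hnq' p hp z hzp zq) z hzp) zm
        · exact Or.inr h
      · rcases hcov' q z (by omega) zq h with ⟨p, hp, hzp⟩ | h
        · exact absurd (hβ p hp (side q n (by simp) (by simp) hnq'.symm p hp z hzp zn) z hzp) zm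
        · exact Or.inr h
  have hk := (hmin _ _ hcut).trans Finset.card_image_le
  have hall := Finset.filter_card_eq (le_antisymm (Finset.card_filter_le _ _) hk)
  have hfr : ∀ z ∈ frontier (f^[n] ⁻¹' V ∪ f^[m] ⁻¹' V), z ∈ G' := by
    intro z hz
    rw [((hop n).union (hop m)).frontier_eq, closure_union] at hz
    obtain ⟨h1, h2⟩ := hz
    simp only [mem_union, not_or] at h2
    rcases h1 with h1 | h1
    · rcases hcov' n z (by omega) (hcl n h1) h2.1 with ⟨p, hp, hzp⟩ | h
      · exact absurd ((hall p hp).1 z hzp) h2.2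
      · exact h
    · rcases hcov' m z (by omega) (hcl m h1) h2.2 with ⟨p, hp, hzp⟩ | h
      · exact absurd ((hall p hp).2 z hzp) h2.1
      · exact h
  have := (rc_sep hf hw hom hG' hfr 0).2 (by left; rw [mem_preimage, rc_fix hw]; exact hwV)
  rcases this with h | h
  · exact hn h
  · exact hmx h

lemma rc_caseB {X : Type*} [TopologicalSpace X] {f : X → X}
    (hf : IsMonotoneMap f) {w x : X} (hw : f w = w)
    {V : Set X} {S : Finset (ℕ × X)} (hm : rcMin f w x V S) {n m q : ℕ}
    (hnm : n ≤ m) (hmq : m ≤ q)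
    (side : ∀ a b, (a = n ∨ a = m ∨ a = q) → (b = n ∨ b = m ∨ b = q) → a ≠ b → ∀ p ∈ S, ∀ z,
      z ∈ rcFib f (rcSh a p) → f^[b] z ∈ closure V → rcSub f V p a b)
    (hnm' : n ≠ m)
    (hα : ∀ p ∈ S, rcSub f V p n m → rcSub f V p n q)
    (hα' : ∀ p ∈ S, rcSub f V p n m → rcSub f V p m q)
    (hβ : ∀ p ∈ S, rcSub f V p m n → rcSub f V p q n)
    (hβ' : ∀ p ∈ S, rcSub f V p m n → rcSub f V p q m)
    (hΔ' : ∀ N, ∃ j, N ≤ j ∧ f^[j] x ∉ V ∧ f^[j + (q - m)] x ∉ V) :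
    ∀ p ∈ S, (rcSub f V p n m ↔ ¬ rcSub f V p m n) := by
  classical
  have hm0 := hm
  obtain ⟨⟨hVo, hwV, hinf, hS, G, hG, hcov⟩, hmin⟩ := hm0
  obtain ⟨G', hG', hGG⟩ := rc_free_all hG q
  have hcl : ∀ n, closure (f^[n] ⁻¹' V) ⊆ f^[n] ⁻¹' closure V := fun n =>
    (hf.1.iterate n).closure_preimage_subset V
  have hop : ∀ n, IsOpen (f^[n] ⁻¹' V) := fun n => hVo.preimage (hf.1.iterate n)
  have hwp : ∀ n, w ∈ f^[n] ⁻¹' V := fun n => by rw [mem_preimage, rc_fix hw]; exact hwV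
  have hcov' : ∀ e z, e ≤ q → f^[e] z ∈ closure V → f^[e] z ∉ V →
      (∃ p ∈ S, z ∈ rcFib f (rcSh e p)) ∨ z ∈ G' := by
    intro e z he h1 h2
    rcases hcov _ h1 h2 with ⟨p, hp, h⟩ | h
    · exact Or.inl ⟨p, hp, rc_fib_sh.2 h⟩
    · exact Or.inr (hGG e he z h)
  set α := S.filter (fun p => rcSub f V p n m) with hαd
  set β := S.filter (fun p => rcSub f V p m n) with hβd
  have hcut1 : rcCut f w x (f^[n] ⁻¹' V ∩ f^[m] ⁻¹' V) (α.image (rcSh n) ∪ β.image (rcSh m)) := by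
    refine ⟨(hop n).inter (hop m), ⟨hwp n, hwp m⟩, ?_, ?_, G', hG', ?_⟩
    · intro N
      obtain ⟨j, hj, hjV⟩ := hinf (N + n)
      refine ⟨j - n, by omega, fun h => ?_⟩
      have h1 := h.1
      rw [mem_preimage, ← iterate_add_apply, show n + (j - n) = j by omega] at h1
      exact hjV h1
    · intro p hp
      rcases Finset.mem_union.1 hp with hp | hp
      · obtain ⟨p', hp', rfl⟩ := Finset.mem_image.1 hp
        exact hS p' (Finset.mem_filter.1 hp').1
      · obtain ⟨p', hp', rfl⟩ := Finset.mem_image.1 hp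
        exact hS p' (Finset.mem_filter.1 hp').1
    · intro z hz hzW
      have hz' := closure_inter_subset_inter_closure _ _ hz
      have zn := hcl n hz'.1
      have zm := hcl m hz'.2
      by_cases h1 : f^[n] z ∈ V
      · have h2 : f^[m] z ∉ V := fun h => hzW ⟨h1, h⟩
        rcases hcov' m z (by omega) zm h2 with ⟨p, hp, hzp⟩ | h
        · left
          refine ⟨rcSh m p, Finset.mem_union_right _ (Finset.mem_image_of_mem _
            (Finset.mem_filter.2 ⟨hp, ?_⟩)), hzp⟩
          exact side m n (by simp) (by simp) hnm'.symm p hp z hzp zn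
        · exact Or.inr h
      · rcases hcov' n z (by omega) zn h1 with ⟨p, hp, hzp⟩ | h
        · left
          refine ⟨rcSh n p, Finset.mem_union_left _ (Finset.mem_image_of_mem _
            (Finset.mem_filter.2 ⟨hp, ?_⟩)), hzp⟩
          exact side n m (by simp) (by simp) hnm' p hp z hzp zm
        · exact Or.inr h
  have hcut2 : rcCut f w x ((f^[n] ⁻¹' V ∩ f^[m] ⁻¹' V) ∪ f^[q] ⁻¹' V)
      ((S \ β).image (rcSh q) ∪ (β \ α).image (rcSh m)) := by
    refine ⟨((hop n).inter (hop m)).union (hop q), Or.inr (hwp q), ?_, ?_, G', hG', ?_⟩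
    · intro N
      obtain ⟨j, hj, hjV, hjV'⟩ := hΔ' (N + m)
      refine ⟨j - m, by omega, ?_⟩
      rintro (h | h)
      · have h1 := h.2
        rw [mem_preimage, ← iterate_add_apply, show m + (j - m) = j by omega] at h1
        exact hjV h1
      · rw [mem_preimage, ← iterate_add_apply, show q + (j - m) = j + (q - m) by omega] at h
        exact hjV' h
    · intro p hp
      rcases Finset.mem_union.1 hp with hp | hp
      · obtain ⟨p', hp', rfl⟩ := Finset.mem_image.1 hp
        exact hS p' (Finset.mem_sdiff.1 hp').1
      · obtain ⟨p', hp', rfl⟩ := Finset.mem_image.1 hp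
        exact hS p' (Finset.mem_filter.1 (Finset.mem_sdiff.1 hp').1).1
    · intro z hz hzW
      have zq : f^[q] z ∉ V := fun h => hzW (Or.inr h)
      have znm : ¬ (f^[n] z ∈ V ∧ f^[m] z ∈ V) := fun h => hzW (Or.inl h)
      by_cases hzq : f^[q] z ∈ closure V
      · rcases hcov' q z le_rfl hzq zq with ⟨p, hp, hzp⟩ | h
        · left
          refine ⟨rcSh q p, Finset.mem_union_left _ (Finset.mem_image_of_mem _
            (Finset.mem_sdiff.2 ⟨hp, fun hpb => ?_⟩)), hzp⟩
          have hb := (Finset.mem_filter.1 hpb).2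
          exact znm ⟨hβ p hp hb z hzp, hβ' p hp hb z hzp⟩
        · exact Or.inr h
      · rw [closure_union] at hz
        have hz1 := hz.resolve_right (fun h => hzq (hcl q h))
        have hz' := closure_inter_subset_inter_closure _ _ hz1
        have zn := hcl n hz'.1
        have zm := hcl m hz'.2
        by_cases h1 : f^[n] z ∈ V
        · have h2 : f^[m] z ∉ V := fun h => znm ⟨h1, h⟩
          rcases hcov' m z (by omega) zm h2 with ⟨p, hp, hzp⟩ | h
          · left
            refine ⟨rcSh m p, Finset.mem_union_right _ (Finset.mem_image_of_mem _
              (Finset.mem_sdiff.2 ⟨Finset.mem_filter.2 ⟨hp, ?_⟩, fun hpa => ?_⟩)), hzp⟩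
            · exact side m n (by simp) (by simp) hnm'.symm p hp z hzp zn
            · exact zq (hα' p hp (Finset.mem_filter.1 hpa).2 z hzp)
          · exact Or.inr h
        · rcases hcov' n z (by omega) zn h1 with ⟨p, hp, hzp⟩ | h
          · exact absurd (hα p hp (side n m (by simp) (by simp) hnm' p hp z hzp zm) z hzp) zq
          · exact Or.inr h
  have k1 : S.card ≤ α.card + β.card := (hmin _ _ hcut1).trans ((Finset.card_union_le _ _).trans
    (add_le_add Finset.card_image_le Finset.card_image_le))
  have k2 : S.card ≤ (S \ β).card + (β \ α).card :=
    (hmin _ _ hcut2).trans ((Finset.card_union_le _ _).trans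
    (add_le_add Finset.card_image_le Finset.card_image_le))
  have k3 : (S \ β).card + β.card = S.card := Finset.card_sdiff_add_card_eq_card (Finset.filter_subset _ _)
  have k4 : (β \ α).card + (β ∩ α).card = β.card := Finset.card_sdiff_add_card_inter _ _
  have k5 : (α ∪ β).card + (α ∩ β).card = α.card + β.card := Finset.card_union_add_card_inter _ _
  rw [Finset.inter_comm] at k4
  have k6 : (α ∩ β).card = 0 := by omega
  have k7 : α ∪ β = S := Finset.eq_of_subset_of_card_le
    (Finset.union_subset (Finset.filter_subset _ _) (Finset.filter_subset _ _)) (by omega)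
  intro p hp
  rw [Finset.card_eq_zero] at k6
  constructor
  · intro h1 h2
    have : p ∈ α ∩ β := Finset.mem_inter.2 ⟨Finset.mem_filter.2 ⟨hp, h1⟩, Finset.mem_filter.2 ⟨hp, h2⟩⟩
    rw [k6] at this
    exact absurd this (Finset.notMem_empty _)
  · intro h2
    rw [← k7] at hp
    rcases Finset.mem_union.1 hp with h | h
    · exact (Finset.mem_filter.1 h).2
    · exact absurd (Finset.mem_filter.1 h).2 h2

lemma rc_phase1 {X : Type*} [TopologicalSpace X] [T1Space X] [LocallyConnectedSpace X] {f : X → X}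
    (hf : IsMonotoneMap f) {w x : X} (hw : f w = w)
    (hom : ∀ U : Set X, IsOpen U → w ∈ U → ∀ N, ∃ j, N ≤ j ∧ f^[j] x ∈ U)
    {V : Set X} {S : Finset (ℕ × X)} (hm : rcMin f w x V S) :
    ∃ (V : Set X) (S : Finset (ℕ × X)) (l : ℕ) (A : ℕ × X → Prop), rcMin f w x V S ∧ 1 ≤ l ∧
      (∀ l', l ≤ l' → ∀ p ∈ S, ∀ p' ∈ S, ∀ z, z ∈ rcFib f p → z ∉ rcFib f (rcSh l' p')) ∧
      ∀ p ∈ S, (A p → (∀ z ∈ rcFib f p, f^[l] z ∈ V) ∧ ∀ z ∈ rcFib f (rcSh l p), z ∉ closure V) ∧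
        (¬ A p → (∀ z ∈ rcFib f (rcSh l p), z ∈ V) ∧ ∀ z ∈ rcFib f p, f^[l] z ∉ closure V) := by
  classical
  obtain ⟨l0, hl1, hl0⟩ := rc_l0 hm hw
  let c : ℕ → ℕ → (S → Prop) × (S → Prop) × Prop := fun n m =>
    (fun p => rcSub f V p n m, fun p => rcSub f V p m n,
      ∀ N, ∃ j, N ≤ j ∧ f^[j] x ∉ V ∧ f^[j + (m - n)] x ∉ V)
  obtain ⟨n, m, q, hn, hmx, hq, hnm, hmq, c1, c2⟩ :=
    rc_ramsey c (fun j => f^[j] x ∉ V) hm.1.2.2.1 l0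
  simp only [c, Prod.mk.injEq, funext_iff, Subtype.forall, eq_iff_iff] at c1 c2
  obtain ⟨c1a, c1b, c1c⟩ := c1
  obtain ⟨c2a, c2b, c2c⟩ := c2
  have side : ∀ a b, (a = n ∨ a = m ∨ a = q) → (b = n ∨ b = m ∨ b = q) → a ≠ b → ∀ p ∈ S, ∀ z,
      z ∈ rcFib f (rcSh a p) → f^[b] z ∈ closure V → rcSub f V p a b := by
    intro a b ha hb hab p hp z hz hzc
    exact rc_side hf hm hl0 (by omega) hp hz hzc
  by_cases hΔ : ∀ N, ∃ j, N ≤ j ∧ f^[j] x ∉ V ∧ f^[j + (m - n)] x ∉ V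
  · have hx := rc_caseB hf hw hm (n := n) (m := m) (q := q) (by omega) (by omega) side (by omega)
      (fun p hp => (c1a p hp).2) (fun p hp => (c2a p hp).2) (fun p hp => (c1b p hp).2)
      (fun p hp => (c2b p hp).2) (c2c.2 hΔ)
    have hm0 := hm
    obtain ⟨⟨hVo, hwV, hinf, hS, G, hG, hcov⟩, hmin⟩ := hm0
    have hcl : ∀ n, closure (f^[n] ⁻¹' V) ⊆ f^[n] ⁻¹' closure V := fun n =>
      (hf.1.iterate n).closure_preimage_subset V
    have esh : ∀ p : ℕ × X, rcSh (m - n) (rcSh n p) = rcSh m p := by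
      intro p
      simp only [rcSh, Prod.mk.injEq, and_true]
      omega
    have eit : ∀ z, f^[n] (f^[m - n] z) = f^[m] z := by
      intro z
      rw [← iterate_add_apply, show n + (m - n) = m by omega]
    refine ⟨f^[n] ⁻¹' V, S.image (rcSh n), m - n, fun p => ∀ z ∈ rcFib f p, f^[m] z ∈ V,
      ⟨⟨?_, ?_, ?_, ?_, ?_⟩, ?_⟩, by omega, ?_, ?_⟩
    · exact hVo.preimage (hf.1.iterate n)
    · rw [mem_preimage, rc_fix hw]; exact hwV
    · intro N
      obtain ⟨j, hj, hjV⟩ := hinf (N + n)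
      refine ⟨j - n, by omega, fun h1 => ?_⟩
      rw [mem_preimage, ← iterate_add_apply, show n + (j - n) = j by omega] at h1
      exact hjV h1
    · intro p hp
      obtain ⟨p', hp', rfl⟩ := Finset.mem_image.1 hp
      exact hS p' hp'
    · obtain ⟨G', hG', hGG⟩ := rc_free_all hG n
      refine ⟨G', hG', fun z hz hz' => ?_⟩
      rcases hcov _ (hcl n hz) hz' with ⟨p, hp, h⟩ | h
      · exact Or.inl ⟨rcSh n p, Finset.mem_image_of_mem _ hp, rc_fib_sh.2 h⟩
      · exact Or.inr (hGG n le_rfl z h)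
    · intro V' S' h
      exact Finset.card_image_le.trans (hmin V' S' h)
    · intro l' hl' p hp p' hp' z hz hz'
      obtain ⟨p1, hp1, rfl⟩ := Finset.mem_image.1 hp
      obtain ⟨p2, hp2, rfl⟩ := Finset.mem_image.1 hp'
      rw [rc_fib_sh] at hz hz'
      rw [rc_fib_sh, ← iterate_add_apply, add_comm, iterate_add_apply] at hz'
      exact hl0 l' (by omega) p1 hp1 p2 hp2 _ hz (rc_fib_sh.2 hz')
    · intro p hp
      obtain ⟨p1, hp1, rfl⟩ := Finset.mem_image.1 hp
      rw [esh]
      constructor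
      · intro hA
        refine ⟨fun z hz => by rw [mem_preimage, eit]; exact hA z hz, fun z hz hzc => ?_⟩
        exact (hx p1 hp1).1 hA (side m n (by simp) (by simp) (by omega) p1 hp1 z hz (hcl n hzc))
      · intro hA
        have hB : rcSub f V p1 m n := by
          by_contra h
          exact hA ((hx p1 hp1).2 h)
        refine ⟨fun z hz => hB z hz, fun z hz hzc => hA ?_⟩
        have := hcl n hzc
        rw [mem_preimage, eit] at this
        exact side n m (by simp) (by simp) (by omega) p1 hp1 z hz this
  · exfalso
    have hΔ' := mt c2c.1 hΔ
    push Not at hΔ hΔ'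
    exact rc_caseA hf hw hom hm (n := n) (m := m) (q := q) (by omega) (by omega) hn hmx side
      (by omega) (by omega) (by omega)
      (fun p hp => (c1a p hp).1) (fun p hp => (c2a p hp).1)
      (fun p hp h => (c2b p hp).2 ((c1b p hp).1 h)) hΔ hΔ'

lemma rc_phase2 {X : Type*} [TopologicalSpace X] {f : X → X}
    (hf : IsMonotoneMap f) {w x : X} (hw : f w = w)
    {V : Set X} {S : Finset (ℕ × X)} (hm : rcMin f w x V S) {l : ℕ} {A : ℕ × X → Prop}
    (hl0 : ∀ l', l ≤ l' → ∀ p ∈ S, ∀ p' ∈ S, ∀ z, z ∈ rcFib f p → z ∉ rcFib f (rcSh l' p'))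
    (hA : ∀ p ∈ S, (A p → (∀ z ∈ rcFib f p, f^[l] z ∈ V) ∧
        ∀ z ∈ rcFib f (rcSh l p), z ∉ closure V) ∧
        (¬ A p → (∀ z ∈ rcFib f (rcSh l p), z ∈ V) ∧ ∀ z ∈ rcFib f p, f^[l] z ∉ closure V))
    (r : ℕ) (hr : 1 ≤ r) :
    ∀ p ∈ S, (A p → ∀ z ∈ rcFib f p, f^[r * l] z ∈ V) ∧
      (¬ A p → ∀ z ∈ rcFib f (rcSh (r * l) p), z ∈ V) := by
  classical
  have hm0 := hm
  obtain ⟨⟨hVo, hwV, hinf, hS, G, hG, hcov⟩, hmin⟩ := hm0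
  have hrl : l ≤ r * l := Nat.le_mul_of_pos_left l hr
  let φ : ℕ × X → ℕ × X := fun p => if A p then p else rcSh (r * l) p
  have main : ∀ p0 ∈ S, (∀ z ∈ rcFib f (φ p0), ∃ s ≤ r, f^[s * l] z ∉ closure V) → False := by
    intro p0 hp0 hbad
    have hcut : rcCut f w x (⋂ s ∈ Set.Iic r, f^[s * l] ⁻¹' V) ((S.erase p0).image φ) := by
      obtain ⟨G', hG', hGG⟩ := rc_free_all hG (r * l)
      refine ⟨(finite_Iic r).isOpen_biInter fun s _ => hVo.preimage (hf.1.iterate _), ?_, ?_, ?_,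
        G', hG', ?_⟩
      · simp only [mem_iInter, mem_preimage, rc_fix hw]
        exact fun _ _ => hwV
      · intro N
        obtain ⟨j, hj, hjV⟩ := hinf N
        refine ⟨j, hj, fun h => hjV ?_⟩
        simp only [mem_iInter] at h
        have := h 0 (Nat.zero_le r)
        simpa using this
      · intro p hp
        obtain ⟨p', hp', rfl⟩ := Finset.mem_image.1 hp
        have h1 := hS p' (Finset.mem_of_mem_erase hp')
        by_cases h : A p'
        · simpa [φ, h] using h1
        · simpa [φ, h, rcSh] using h1
      · intro z hz hzW
        have hc : ∀ s ≤ r, f^[s * l] z ∈ closure V := by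
          intro s hs
          have h1 : closure (⋂ s ∈ Set.Iic r, f^[s * l] ⁻¹' V) ⊆ closure (f^[s * l] ⁻¹' V) :=
            closure_mono (biInter_subset_of_mem hs)
          exact (hf.1.iterate _).closure_preimage_subset V (h1 hz)
        simp only [mem_iInter, not_forall] at hzW
        obtain ⟨s, hs, hsV⟩ := hzW
        have hs' : s ≤ r := hs
        rcases hcov _ (hc s hs') hsV with ⟨p, hp, hzp⟩ | h
        · have hzφ : z ∈ rcFib f (φ p) := by
            by_cases h : A p
            · simp only [φ, h, if_true]
              rcases Nat.eq_zero_or_pos s with h0 | h0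
              · subst h0; simpa using hzp
              · exfalso
                obtain ⟨t, rfl⟩ : ∃ t, s = t + 1 := ⟨s - 1, by omega⟩
                refine ((hA p hp).1 h).2 (f^[t * l] z) ?_ (hc t (by omega))
                rw [rc_fib_sh, ← iterate_add_apply]
                convert hzp using 2
                ring_nf
            · simp only [φ, h, if_false]
              rcases Nat.lt_or_ge s r with h0 | h0
              · exfalso
                refine ((hA p hp).2 h).2 (f^[s * l] z) hzp ?_
                have := hc (s + 1) (by omega)
                rw [← iterate_add_apply]
                convert this using 2
                ring_nf
              · have : s = r := by omega
                subst this
                exact rc_fib_sh.2 hzp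
          left
          refine ⟨φ p, Finset.mem_image_of_mem _ (Finset.mem_erase.2 ⟨?_, hp⟩), hzφ⟩
          rintro rfl
          obtain ⟨s, hs, h⟩ := hbad z hzφ
          exact h (hc s hs)
        · exact Or.inr (hGG (s * l) (Nat.mul_le_mul_right l hs') z h)
    have h1 := (hmin _ _ hcut).trans Finset.card_image_le
    have h2 := Finset.card_erase_lt_of_mem hp0
    omega
  intro p hp
  constructor
  · intro hAp z hz
    by_contra hzV
    refine main p hp fun u hu => ⟨r, le_rfl, fun huc => hzV ?_⟩
    simp only [φ, hAp, if_true] at hu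
    exact rc_side hf hm hl0 (n := 0) (m := r * l) (Or.inl (by omega)) hp hu huc z hz
  · intro hAp z hz
    by_contra hzV
    refine main p hp fun u hu => ⟨0, by omega, fun huc => hzV ?_⟩
    simp only [φ, hAp, if_false] at hu
    exact rc_side hf hm hl0 (n := r * l) (m := 0) (Or.inr (by omega)) hp hu (by simpa using huc) z hz

lemma rc_block (P : ℕ → Prop) (h1 : ∀ N, ∃ j, N ≤ j ∧ P j) (h2 : ∀ N, ∃ j, N ≤ j ∧ ¬ P j) :
    ∃ m r, 1 ≤ r ∧ ¬ P m ∧ P (m + 1) ∧ P (m + r) ∧ ¬ P (m + r + 1) := by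
  classical
  obtain ⟨a, -, ha⟩ := h2 0
  have hb : ∃ t, P (a + t) := by
    obtain ⟨j, hj, hP⟩ := h1 a
    exact ⟨j - a, by rwa [show a + (j - a) = j by omega]⟩
  have hb1 := Nat.find_spec hb
  have hb2 := fun t (ht : t < Nat.find hb) => Nat.find_min hb ht
  set t := Nat.find hb
  have ht : t ≠ 0 := by
    intro h; rw [h] at hb1; exact ha hb1
  have he : ∃ e, ¬ P (a + t + e) := by
    obtain ⟨j, hj, hP⟩ := h2 (a + t)
    exact ⟨j - (a + t), by rwa [show a + t + (j - (a + t)) = j by omega]⟩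
  have he1 := Nat.find_spec he
  have he2 := fun t (ht : t < Nat.find he) => Nat.find_min he ht
  set e := Nat.find he
  have hne : e ≠ 0 := by
    intro h; rw [h] at he1; exact he1 hb1
  have h3 := not_not.1 (he2 (e - 1) (by omega))
  refine ⟨a + (t - 1), e, by omega, hb2 (t - 1) (by omega), ?_, ?_, ?_⟩
  · rwa [show a + (t - 1) + 1 = a + t by omega]
  · rwa [show a + (t - 1) + e = a + t + (e - 1) by omega]
  · rwa [show a + (t - 1) + e + 1 = a + t + e by omega]

lemma rc_nomin {X : Type*} [TopologicalSpace X] [T1Space X] [LocallyConnectedSpace X] {f : X → X}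
    (hf : IsMonotoneMap f) {w x : X} (hw : f w = w)
    (hom : ∀ U : Set X, IsOpen U → w ∈ U → ∀ N, ∃ j, N ≤ j ∧ f^[j] x ∈ U)
    {V : Set X} {S : Finset (ℕ × X)} (hm : rcMin f w x V S) : False := by
  obtain ⟨V, S, l, A, hm, hl, hl0, hA⟩ := rc_phase1 hf hw hom hm
  have hph := rc_phase2 hf hw hm hl0 hA
  have hm0 := hm
  obtain ⟨⟨hVo, hwV, hinf, hS, G, hG, hcov⟩, hmin⟩ := hm0
  have hres : ∃ ρ, ∀ N, ∃ j, N ≤ j ∧ f^[ρ + j * l] x ∉ V := by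
    by_contra hno
    push Not at hno
    choose N hN using hno
    obtain ⟨j, hj, hjV⟩ := hinf ((Finset.range l).sup (fun ρ => N ρ + 1) * l + l)
    refine hjV ?_
    have h1 : j % l < l := Nat.mod_lt _ hl
    have h2 : N (j % l) + 1 ≤ (Finset.range l).sup (fun ρ => N ρ + 1) :=
      Finset.le_sup (f := fun ρ => N ρ + 1) (Finset.mem_range.2 h1)
    have h3 := hN (j % l) (j / l) (by
      rw [Nat.le_div_iff_mul_le hl]
      have : N (j % l) * l ≤ (Finset.range l).sup (fun ρ => N ρ + 1) * l :=
        Nat.mul_le_mul_right l (by omega)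
      omega)
    rwa [mul_comm, Nat.mod_add_div] at h3
  obtain ⟨ρ, hρ⟩ := hres
  have hin : ∀ N, ∃ j, N ≤ j ∧ f^[ρ + j * l] x ∈ V := by
    intro N
    obtain ⟨t, ht, htU⟩ := hom (⋂ s ∈ Set.Iic l, f^[s] ⁻¹' V)
      ((finite_Iic l).isOpen_biInter fun s _ => hVo.preimage (hf.1.iterate _))
      (by simp only [mem_iInter, mem_preimage, rc_fix hw]; exact fun _ _ => hwV) (ρ + N * l)
    simp only [mem_iInter] at htU
    obtain ⟨d, rfl⟩ := Nat.exists_eq_add_of_le ht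
    have h1 : d % l < l := Nat.mod_lt _ hl
    have h2 := htU (l - d % l) (show _ ≤ l by omega)
    refine ⟨N + d / l + 1, (Nat.le_add_right _ _).trans (Nat.le_add_right _ _), ?_⟩
    rw [mem_preimage, ← iterate_add_apply] at h2
    have h3 := Nat.div_add_mod d l
    have : ρ + (N + d / l + 1) * l = l - d % l + (ρ + N * l + d) := by
      have : (N + d / l + 1) * l = N * l + l * (d / l) + l := by ring
      omega
    rwa [this]
  obtain ⟨m, r, hr, hm1, hm2, hm3, hm4⟩ := rc_block (fun j => f^[ρ + j * l] x ∈ V) hin hρ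
  obtain ⟨G', hG', hGG⟩ := rc_free_all hG ((r + 1) * l)
  have hcov' : ∀ e z, e ≤ (r + 1) * l → f^[e] z ∈ closure V → f^[e] z ∉ V →
      (∃ p ∈ S, f^[e] z ∈ rcFib f p) ∨ z ∈ G' := by
    intro e z he h1 h2
    rcases hcov _ h1 h2 with ⟨p, hp, h⟩ | h
    · exact Or.inl ⟨p, hp, h⟩
    · exact Or.inr (hGG e he z h)
  have hcont := fun n => hf.1.iterate n
  set E : Set X := Vᶜ ∩ f^[l] ⁻¹' V ∩ f^[r * l] ⁻¹' V ∩ f^[(r + 1) * l] ⁻¹' Vᶜ with hE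
  have hclE : closure E ⊆ Vᶜ ∩ f^[l] ⁻¹' closure V ∩ f^[r * l] ⁻¹' closure V ∩
      f^[(r + 1) * l] ⁻¹' Vᶜ := by
    refine closure_minimal ?_ ?_
    · rintro z ⟨⟨⟨h1, h2⟩, h3⟩, h4⟩
      exact ⟨⟨⟨h1, subset_closure h2⟩, subset_closure h3⟩, h4⟩
    · exact ((hVo.isClosed_compl.inter (isClosed_closure.preimage (hcont _))).inter
        (isClosed_closure.preimage (hcont _))).inter (hVo.isClosed_compl.preimage (hcont _))
  have hintE : (closure V)ᶜ ∩ f^[l] ⁻¹' V ∩ f^[r * l] ⁻¹' V ∩ f^[(r + 1) * l] ⁻¹' (closure V)ᶜ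
      ⊆ interior E := by
    refine interior_maximal ?_ ?_
    · rintro z ⟨⟨⟨h1, h2⟩, h3⟩, h4⟩
      exact ⟨⟨⟨fun h => h1 (subset_closure h), h2⟩, h3⟩, fun h => h4 (subset_closure h)⟩
    · exact ((isClosed_closure.isOpen_compl.inter (hVo.preimage (hcont _))).inter
        (hVo.preimage (hcont _))).inter (isClosed_closure.isOpen_compl.preimage (hcont _))
  have el : l ≤ (r + 1) * l := Nat.le_mul_of_pos_left l (by omega)
  have erl : r * l ≤ (r + 1) * l := Nat.mul_le_mul_right l (by omega)
  have i1 : ∀ z, f^[r * l] (f^[l] z) = f^[(r + 1) * l] z := by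
    intro z; rw [← iterate_add_apply]; congr 2; ring
  have i2 : ∀ z, f^[l] (f^[r * l] z) = f^[(r + 1) * l] z := by
    intro z; rw [← iterate_add_apply]; congr 2; ring
  have hfr : ∀ z ∈ frontier E, z ∈ G' := by
    rintro z ⟨hz1, hz2⟩
    obtain ⟨⟨⟨a1, a2⟩, a3⟩, a4⟩ := hclE hz1
    have a1 : z ∉ V := a1
    have a2 : f^[l] z ∈ closure V := a2
    have a3 : f^[r * l] z ∈ closure V := a3
    have a4 : f^[(r + 1) * l] z ∉ V := a4
    by_cases b1 : z ∈ closure V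
    · rcases hcov' 0 z (by omega) b1 a1 with ⟨p, hp, hzp⟩ | h
      · exfalso
        have hzp : z ∈ rcFib f p := hzp
        by_cases h : A p
        · exact a4 ((hph (r + 1) (by omega) p hp).1 h z hzp)
        · exact ((hA p hp).2 h).2 z hzp a2
      · exact h
    by_cases b2 : f^[l] z ∈ V
    swap
    · rcases hcov' l z el a2 b2 with ⟨p, hp, hzp⟩ | h
      · exfalso
        by_cases h : A p
        · have := (hph r hr p hp).1 h _ hzp
          rw [i1] at this
          exact a4 this
        · exact a1 (((hA p hp).2 h).1 z (rc_fib_sh.2 hzp))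
      · exact h
    by_cases b3 : f^[r * l] z ∈ V
    swap
    · rcases hcov' (r * l) z erl a3 b3 with ⟨p, hp, hzp⟩ | h
      · exfalso
        by_cases h : A p
        · have := ((hA p hp).1 h).1 _ hzp
          rw [i2] at this
          exact a4 this
        · exact a1 ((hph r hr p hp).2 h z (rc_fib_sh.2 hzp))
      · exact h
    by_cases b4 : f^[(r + 1) * l] z ∈ closure V
    · rcases hcov' ((r + 1) * l) z le_rfl b4 a4 with ⟨p, hp, hzp⟩ | h
      · exfalso
        by_cases h : A p
        · refine ((hA p hp).1 h).2 (f^[r * l] z) ?_ a3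
          rw [rc_fib_sh, i2]
          exact hzp
        · exact a1 ((hph (r + 1) (by omega) p hp).2 h z (rc_fib_sh.2 hzp))
      · exact h
    exact absurd (hintE ⟨⟨⟨b1, b2⟩, b3⟩, b4⟩) hz2
  have := (rc_sep hf hw hom hG' hfr (ρ + m * l)).1 (by
    refine ⟨⟨⟨hm1, ?_⟩, ?_⟩, ?_⟩
    · rw [mem_preimage, ← iterate_add_apply]
      convert hm2 using 2
      ring_nf
    · rw [mem_preimage, ← iterate_add_apply]
      convert hm3 using 2
      ring_nf
    · rw [mem_preimage, ← iterate_add_apply]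
      intro h
      apply hm4
      convert h using 2
      ring_nf)
  exact this.1.1.1 hwV

lemma rc_fixed {X : Type*} [MetricSpace X] [ConnectedSpace X] (hX : IsRegCurve X) {f : X → X}
    (hf : IsMonotoneMap f) {w x : X} (hw : f w = w)
    (hom : ∀ U : Set X, IsOpen U → w ∈ U → ∀ N, ∃ j, N ≤ j ∧ f^[j] x ∈ U) :
    Tendsto (fun n => f^[n] x) atTop (𝓝 w) := by
  classical
  have := rc_lc hX
  by_contra hno
  rw [tendsto_atTop_nhds] at hno
  push Not at hno
  obtain ⟨V0, hwV0, hV0, hinf0⟩ := hno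
  obtain ⟨U, hU, hwU, hUV, hF⟩ := hX w V0 hV0 hwV0
  have hex : ∃ k : ℕ, ∃ V S, rcCut f w x V S ∧ S.card = k := by
    refine ⟨_, U, hF.toFinset.image (fun a => (0, a)), ⟨hU, hwU, ?_, ?_, ∅, rc_free_empty f w, ?_⟩, rfl⟩
    · intro N
      obtain ⟨j, hj, hjV⟩ := hinf0 N
      exact ⟨j, hj, fun h => hjV (hUV h)⟩
    · intro p hp
      obtain ⟨a, ha, rfl⟩ := Finset.mem_image.1 hp
      rw [Set.Finite.mem_toFinset, hU.frontier_eq] at ha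
      rintro rfl
      exact ha.2 hwU
    · intro z hz hz'
      left
      refine ⟨(0, z), Finset.mem_image_of_mem _ ?_, rfl⟩
      rw [Set.Finite.mem_toFinset, hU.frontier_eq]
      exact ⟨hz, hz'⟩
  obtain ⟨V, S, hcut, hk⟩ := Nat.find_spec hex
  refine rc_nomin hf hw hom (V := V) (S := S) ⟨hcut, fun V' S' h => ?_⟩
  rw [hk]
  exact Nat.find_min' hex ⟨V', S', h, rfl⟩

lemma rc_mem_omega {X : Type*} [TopologicalSpace X] {f : X → X} {x y : X} :
    y ∈ omegaLimitSet f x ↔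
      ∀ U : Set X, IsOpen U → y ∈ U → ∀ N, ∃ j, N ≤ j ∧ f^[j] x ∈ U := by
  simp only [omegaLimitSet, mem_iInter, _root_.mem_closure_iff]
  constructor
  · intro h U hU hy N
    obtain ⟨_, h1, j, hj, rfl⟩ := h N U hU hy
    exact ⟨j, hj, h1⟩
  · intro h N U hU hy
    obtain ⟨j, hj, h1⟩ := h U hU hy N
    exact ⟨_, h1, j, hj, rfl⟩

lemma rc_per_case {X : Type*} [MetricSpace X] [ConnectedSpace X] (hX : IsRegCurve X) {f : X → X}
    (hf : IsMonotoneMap f) {w x y : X} {d : ℕ} (hd : 1 ≤ d) (hw : f^[d] w = w)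
    (hwx : w ∈ omegaLimitSet f x) (hy : y ∈ omegaLimitSet f x) : f^[d] y = y := by
  rw [rc_mem_omega] at hwx hy
  have hi : ∃ i, ∀ U : Set X, IsOpen U → w ∈ U → ∀ N, ∃ j, N ≤ j ∧ (f^[d])^[j] (f^[i] x) ∈ U := by
    by_contra hno
    push Not at hno
    choose U hU hwU N hN using hno
    obtain ⟨j, hj, hjU⟩ := hwx (⋂ i ∈ Set.Iio d, U i)
      ((finite_Iio d).isOpen_biInter fun i _ => hU i) (by simp only [mem_iInter]; exact fun i _ => hwU i)
      ((Finset.range d).sup N * d)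
    simp only [mem_iInter] at hjU
    have h1 : j % d < d := Nat.mod_lt _ hd
    have h2 : N (j % d) ≤ (Finset.range d).sup N := Finset.le_sup (Finset.mem_range.2 h1)
    have h3 := hN (j % d) (j / d) (by
      rw [Nat.le_div_iff_mul_le hd]
      exact (Nat.mul_le_mul_right d h2).trans hj)
    rw [← iterate_mul, ← iterate_add_apply, Nat.div_add_mod] at h3
    exact h3 (hjU _ h1)
  obtain ⟨i, hi⟩ := hi
  have hconv := rc_fixed hX (rc_iter hf d) hw hi
  set T : Set X := (fun r => f^[r] w) '' Set.Iio d with hT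
  have hTf : T.Finite := (finite_Iio d).image _
  have hyT : y ∈ T := by
    by_contra hyT
    obtain ⟨C, hC, hCc, hCT⟩ := exists_mem_nhds_isClosed_subset (hTf.isClosed.isOpen_compl.mem_nhds hyT)
    have hev : ∀ r ∈ Set.Iio d, ∀ᶠ n in atTop, f^[r] ((f^[d])^[n] (f^[i] x)) ∈ Cᶜ := by
      intro r hr
      have h1 : Tendsto (fun n => f^[r] ((f^[d])^[n] (f^[i] x))) atTop (𝓝 (f^[r] w)) :=
        ((hf.1.iterate r).tendsto w).comp hconv
      exact h1.eventually (hCc.isOpen_compl.mem_nhds fun h => hCT h ⟨r, hr, rfl⟩)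
    have hev' := (Filter.eventually_all_finite (finite_Iio d)).2 hev
    obtain ⟨N, hN⟩ := eventually_atTop.1 hev'
    obtain ⟨j, hj, hjC⟩ := hy (interior C) isOpen_interior (mem_interior_iff_mem_nhds.2 hC) (i + N * d)
    obtain ⟨e, rfl⟩ := Nat.exists_eq_add_of_le hj
    have h1 := hN (N + e / d) (Nat.le_add_right _ _) (e % d) (Nat.mod_lt _ hd)
    rw [← iterate_mul, ← iterate_add_apply, ← iterate_add_apply] at h1
    refine h1 ?_
    have h3 := Nat.div_add_mod e d
    have h4 : e % d + d * (N + e / d) + i = i + N * d + e := by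
      have : d * (N + e / d) = N * d + d * (e / d) := by ring
      omega
    rw [h4]
    exact interior_subset hjC
  obtain ⟨r, -, rfl⟩ := hyT
  simp only
  rw [← iterate_add_apply, add_comm, iterate_add_apply, hw]

lemma rc_hit {X : Type*} [MetricSpace X] [CompactSpace X] (hX : IsRegCurve X) {ε : ℝ} (hε : 0 < ε) :
    ∃ F : Finset X, ∀ Q : Set X, IsPreconnected Q → ∀ a ∈ Q, ∀ b ∈ Q, ε ≤ dist a b →
      ∃ p ∈ F, p ∈ Q := by
  classical
  choose U hUo hzU hUb hUf using fun z : X => hX z (ball z (ε / 2)) isOpen_ball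
    (mem_ball_self (by linarith))
  obtain ⟨t, ht⟩ := isCompact_univ.elim_finite_subcover U hUo
    (fun z _ => mem_iUnion.2 ⟨z, hzU z⟩)
  refine ⟨t.biUnion fun z => (hUf z).toFinset, fun Q hQ a ha b hb hab => ?_⟩
  by_contra hno
  push Not at hno
  obtain ⟨z, hz, haz⟩ := mem_iUnion₂.1 (ht (mem_univ a))
  have hbz : b ∈ U z := rc_precon hQ (fun q hq hqf => hno q
    (Finset.mem_biUnion.2 ⟨z, hz, (hUf z).mem_toFinset.2 hqf⟩) hq) ha haz hb
  have h1 := mem_ball.1 (hUb z haz)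
  have h2 := mem_ball'.1 (hUb z hbz)
  have := dist_triangle a z b
  linarith

lemma rc_min_exists {X : Type*} [TopologicalSpace X] [CompactSpace X] [T2Space X] {f : X → X}
    (hf : Continuous f) {L : Set X} (hL : IsClosed L) (hne : L.Nonempty) (hLi : MapsTo f L L) :
    ∃ M, M ⊆ L ∧ IsClosed M ∧ M.Nonempty ∧ MapsTo f M M ∧
      ∀ A ⊆ M, IsClosed A → A.Nonempty → MapsTo f A A → A = M := by
  obtain ⟨M, hML, hM⟩ := zorn_superset_nonempty
    {A : Set X | IsClosed A ∧ A.Nonempty ∧ MapsTo f A A} (by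
      intro c hc hch hcn
      refine ⟨⋂₀ c, ⟨isClosed_sInter fun s hs => (hc hs).1, ?_, ?_⟩, fun s hs => sInter_subset_of_mem hs⟩
      · have : Nonempty c := hcn.to_subtype
        refine IsCompact.nonempty_sInter_of_directed_nonempty_isCompact_isClosed ?_
          (fun s hs => (hc hs).2.1) (fun s hs => (hc hs).1.isCompact) (fun s hs => (hc hs).1)
        intro a ha b hb
        rcases hch.total ha hb with h | h
        · exact ⟨a, ha, Subset.rfl, h⟩
        · exact ⟨b, hb, h, Subset.rfl⟩
      · intro z hz s hs
        exact (hc hs).2.2 (hz s hs)) L ⟨hL, hne, hLi⟩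
  refine ⟨M, hML, hM.prop.1, hM.prop.2.1, hM.prop.2.2, fun A hA h1 h2 h3 => ?_⟩
  exact hA.antisymm (hM.le_of_le ⟨h1, h2, h3⟩ hA)

lemma rc_minimal_case {X : Type*} [MetricSpace X] [CompactSpace X] [ConnectedSpace X]
    (hX : IsRegCurve X) {f : X → X} (hf : IsMonotoneMap f) {x y : X}
    (hnp : ∀ u ∈ omegaLimitSet f x, ∀ d, 1 ≤ d → f^[d] u ≠ u)
    (hy : y ∈ omegaLimitSet f x) :
    ∃ M, y ∈ M ∧ IsClosed M ∧ MapsTo f M M ∧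
      ∀ A ⊆ M, IsClosed A → A.Nonempty → MapsTo f A A → A = M := by
  classical
  have := rc_lc hX
  have hLc : IsClosed (omegaLimitSet f x) := isClosed_iInter fun _ => isClosed_closure
  have hLi : MapsTo f (omegaLimitSet f x) (omegaLimitSet f x) := by
    intro u hu
    rw [rc_mem_omega] at hu ⊢
    intro U hU hfu N
    obtain ⟨j, hj, h⟩ := hu _ (hU.preimage hf.1) hfu N
    exact ⟨j + 1, by omega, by rw [iterate_succ_apply']; exact h⟩
  obtain ⟨M, hML, hMc, ⟨u, hu⟩, hMi, hmin⟩ := rc_min_exists hf.1 hLc ⟨y, hy⟩ hLi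
  refine ⟨M, ?_, hMc, hMi, hmin⟩
  by_contra hyM
  have hsurj : f '' M = M := hmin _ hMi.image_subset (hMc.isCompact.image hf.1).isClosed
    ⟨_, u, hu, rfl⟩ (by rintro _ ⟨a, ha, rfl⟩; exact ⟨f a, hMi ha, rfl⟩)
  have hsurj' : ∀ n, ∃ v ∈ M, f^[n] v = u := by
    have h : ∀ n, ∀ a ∈ M, ∃ v ∈ M, f^[n] v = a := by
      intro n
      induction n with
      | zero => exact fun a ha => ⟨a, ha, rfl⟩
      | succ n ih =>
        intro a ha
        rw [← hsurj] at ha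
        obtain ⟨b, hb, rfl⟩ := ha
        obtain ⟨v, hv, rfl⟩ := ih b hb
        exact ⟨v, hv, by rw [iterate_succ_apply']⟩
    exact fun n => h n u hu
  obtain ⟨δ, hδ, hball⟩ := Metric.isOpen_iff.1 hMc.isOpen_compl y hyM
  have hε : 0 < δ / 2 := by linarith
  obtain ⟨F, hF⟩ := rc_hit hX hε
  have hfr : ∃ᶠ j in atTop, f^[j] x ∈ ball y (δ / 2) := by
    rw [frequently_atTop]
    intro N
    obtain ⟨j, hj, h⟩ := rc_mem_omega.1 hy (ball y (δ / 2)) isOpen_ball (mem_ball_self hε) N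
    exact ⟨j, hj, h⟩
  obtain ⟨φ, hφ, hφb⟩ := extraction_of_frequently_atTop hfr
  set B := φ F.card with hB
  have hV : ∀ q : ℕ, ∃ V : Set X, IsOpen V ∧ u ∈ V ∧ (1 ≤ q → ∀ z ∈ V, f^[q] z ∉ V) := by
    intro q
    by_cases hq : 1 ≤ q
    · obtain ⟨V1, V2, h1, h2, h3, h4, h5⟩ := t2_separation (hnp u (hML hu) q hq)
      refine ⟨V2 ∩ f^[q] ⁻¹' V1, h2.inter (h1.preimage (hf.1.iterate q)), ⟨h4, h3⟩, fun _ z hz hz' => ?_⟩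
      exact Set.disjoint_left.1 h5 hz.2 hz'.1
    · exact ⟨univ, isOpen_univ, trivial, fun h => absurd h hq⟩
  choose V hVo huV hVq using hV
  have hVn : (⋂ q ∈ Set.Iic B, V q) ∈ 𝓝 u :=
    ((finite_Iic B).isOpen_biInter fun q _ => hVo q).mem_nhds (by
      simp only [mem_iInter]; exact fun q _ => huV q)
  obtain ⟨C, hCn, hCp, hCV⟩ := locallyConnectedSpace_iff_connected_subsets.1 this u _ hVn
  have hC : ∀ q, 1 ≤ q → q ≤ B → ∀ z ∈ C, f^[q] z ∉ C := by
    intro q h1 h2 z hz hz'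
    have e1 := hCV hz
    have e2 := hCV hz'
    simp only [mem_iInter] at e1 e2
    exact hVq q h1 z (e1 q h2) (e2 q h2)
  obtain ⟨m, hmB, hmC⟩ := rc_mem_omega.1 (hML hu) (interior C) isOpen_interior
    (mem_interior_iff_mem_nhds.2 hCn) B
  have hle : ∀ a, a ≤ F.card → φ a ≤ B := fun a ha => hφ.monotone ha
  have hpt : ∀ a : ℕ, ∃ p, a ≤ F.card → p ∈ F ∧ f^[m - φ a] p ∈ C := by
    intro a
    by_cases ha : a ≤ F.card
    · obtain ⟨v, hv, hvu⟩ := hsurj' (m - φ a)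
      obtain ⟨p, hp, hpQ⟩ := hF (f^[m - φ a] ⁻¹' C) ((rc_iter hf _).2 C hCp) (f^[φ a] x) (by
          rw [mem_preimage, ← iterate_add_apply, Nat.sub_add_cancel ((hle a ha).trans hmB)]
          exact interior_subset hmC) v (by rw [mem_preimage, hvu]; exact mem_of_mem_nhds hCn) (by
          by_contra hlt
          push Not at hlt
          have h1 : v ∈ ball y δ := by
            have h2 := mem_ball'.1 (hφb a)
            have h3 := dist_triangle y (f^[φ a] x) v
            rw [mem_ball']
            linarith
          exact hball h1 hv)
      exact ⟨p, fun _ => ⟨hp, hpQ⟩⟩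
    · exact ⟨u, fun h => absurd h ha⟩
  choose p hp using hpt
  have hcontra : ∀ a b, a < b → b ≤ F.card → p a = p b → False := by
    intro a b hab hb hpp
    have h1 := (hp a (by omega)).2
    have h2 := (hp b hb).2
    rw [hpp] at h1
    have h3 := hφ hab
    have h4 := hle b hb
    have h5 : m - φ a = (φ b - φ a) + (m - φ b) := by omega
    rw [h5, iterate_add_apply] at h1
    exact hC (φ b - φ a) (by omega) (by omega) _ h2 h1
  obtain ⟨a, ha, b, hb, hab, hpab⟩ := Finset.exists_ne_map_eq_of_card_lt_of_maps_to
    (s := Finset.range (F.card + 1)) (t := F) (by simp) (f := p)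
    (fun a ha => (hp a (by have := Finset.mem_range.1 (Finset.mem_coe.1 ha); omega)).1)
  have ha := Finset.mem_range.1 ha
  have hb := Finset.mem_range.1 hb
  rcases lt_or_gt_of_ne hab with h | h
  · exact hcontra a b h (by omega) hpab
  · exact hcontra b a h (by omega) hpab.symm

lemma rc_main {X : Type*} [MetricSpace X] [CompactSpace X] [ConnectedSpace X]
    (hX : IsRegCurve X) {f : X → X} (hf : IsMonotoneMap f) {x y : X}
    (hy : y ∈ omegaLimitSet f x) (U : Set X) (hU : IsOpen U) (hyU : y ∈ U) :
    ∃ N : ℕ, ∀ k : ℕ, ∃ i : ℕ, i ≤ N ∧ f^[i + k] y ∈ U := by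
  by_cases hper : ∃ w ∈ omegaLimitSet f x, ∃ d, 1 ≤ d ∧ f^[d] w = w
  · obtain ⟨w, hw, d, hd, hdw⟩ := hper
    have h := rc_per_case hX hf hd hdw hw hy
    refine ⟨d, fun k => ⟨d - k % d, by omega, ?_⟩⟩
    have h1 : k % d < d := Nat.mod_lt _ hd
    have h2 := Nat.div_add_mod k d
    have h3 : d - k % d + k = d * (k / d + 1) := by rw [mul_add]; omega
    rw [h3, iterate_mul, rc_fix h]
    exact hyU
  · push Not at hper
    obtain ⟨M, hyM, hMc, hMi, hmin⟩ := rc_minimal_case hX hf hper hy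
    have hcov : M ⊆ ⋃ i, f^[i] ⁻¹' U := by
      intro v hv
      by_contra hv'
      have hA : (M ∩ ⋂ i, f^[i] ⁻¹' Uᶜ) = M := by
        refine hmin _ inter_subset_left (hMc.inter (isClosed_iInter fun i =>
          hU.isClosed_compl.preimage (hf.1.iterate i))) ⟨v, hv, ?_⟩ ?_
        · simp only [mem_iUnion, not_exists] at hv'
          exact mem_iInter.2 hv'
        · rintro z ⟨h1, h2⟩
          refine ⟨hMi h1, mem_iInter.2 fun i => ?_⟩
          rw [mem_preimage, ← iterate_succ_apply]
          exact mem_iInter.1 h2 (i + 1)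
      rw [← hA] at hyM
      exact mem_iInter.1 hyM.2 0 hyU
    obtain ⟨t, ht⟩ := hMc.isCompact.elim_finite_subcover _
      (fun i => hU.preimage (hf.1.iterate i)) hcov
    refine ⟨t.sup id, fun k => ?_⟩
    obtain ⟨i, hi, h⟩ := mem_iUnion₂.1 (ht (rc_inv hMi k hyM))
    refine ⟨i, Finset.le_sup (f := id) hi, ?_⟩
    rw [iterate_add_apply]
    exact h

theorem stmt_3 {X : Type*} [MetricSpace X] [CompactSpace X] [ConnectedSpace X]
    (hX : IsRegCurve X) (f : X → X) (hf : IsMonotoneMap f) :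
    (⋃ x : X, omegaLimitSet f x) = {x : X | x ∈ omegaLimitSet f x} ∧
      {x : X | x ∈ omegaLimitSet f x} =
        {x : X | ∀ U : Set X, IsOpen U → x ∈ U →
          ∃ N : ℕ, ∀ k : ℕ, ∃ i : ℕ, i ≤ N ∧ f^[i + k] x ∈ U} := by
  have hAPR : ∀ x : X, (∀ U : Set X, IsOpen U → x ∈ U →
      ∃ N : ℕ, ∀ k : ℕ, ∃ i : ℕ, i ≤ N ∧ f^[i + k] x ∈ U) → x ∈ omegaLimitSet f x := by
    intro x hx
    rw [rc_mem_omega]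
    intro U hU hxU N
    obtain ⟨_, h⟩ := hx U hU hxU
    obtain ⟨i, -, hi⟩ := h N
    exact ⟨i + N, by omega, hi⟩
  refine ⟨Subset.antisymm ?_ ?_, Subset.antisymm ?_ ?_⟩
  · intro y hy
    obtain ⟨x, hx⟩ := mem_iUnion.1 hy
    exact hAPR y (rc_main hX hf hx)
  · intro y hy
    exact mem_iUnion.2 ⟨y, hy⟩
  · intro y hy
    exact rc_main hX hf hy
  · intro y hy
    exact hAPR y hy
end

section
/- Let X be a regular curve, f : X → X a monotone continuous map, and M an infinite minimal set of f. Then the basin of attraction A(M) = {x ∈ X : ω_f(x) = M} satisfies f(A(M)) ⊆ A(M) and A(M) is closed in X. -/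
open Set Filter Metric Topology Function

theorem aux_mem_omega {X : Type*} [TopologicalSpace X] (f : X → X) (x q : X) :
    q ∈ omegaLimitSet f x ↔ MapClusterPt q atTop (fun k => f^[k] x) := by
  rw [mapClusterPt_iff_frequently]
  simp only [omegaLimitSet, mem_iInter, mem_closure_iff_nhds, frequently_atTop]
  constructor
  · intro h s hs n
    obtain ⟨_, h1, k, hk, rfl⟩ := h n s hs
    exact ⟨k, hk, h1⟩
  · intro h n s hs
    obtain ⟨k, hk, h1⟩ := h s hs n
    exact ⟨_, h1, k, hk, rfl⟩

theorem aux_closed_omega {X : Type*} [TopologicalSpace X] (f : X → X) (x : X) :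
    IsClosed (omegaLimitSet f x) :=
  isClosed_iInter fun _ => isClosed_closure

theorem aux_inv_omega {X : Type*} [TopologicalSpace X] (f : X → X) (hf : Continuous f) (x q : X)
    (hq : q ∈ omegaLimitSet f x) : f q ∈ omegaLimitSet f x := by
  rw [aux_mem_omega, mapClusterPt_iff_frequently] at *
  intro s hs
  have := hq _ (hf.continuousAt hs)
  rw [frequently_atTop] at *
  intro n
  obtain ⟨k, hk, h⟩ := this n
  refine ⟨k + 1, by omega, ?_⟩
  rw [Function.iterate_succ_apply']
  exact h

theorem aux_omega_image {X : Type*} [TopologicalSpace X] (f : X → X) (x : X) :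
    omegaLimitSet f (f x) = omegaLimitSet f x := by
  ext q
  rw [aux_mem_omega, aux_mem_omega, mapClusterPt_iff_frequently, mapClusterPt_iff_frequently]
  simp only [frequently_atTop]
  constructor
  · intro h s hs n
    obtain ⟨k, hk, h1⟩ := h s hs n
    exact ⟨k + 1, by omega, by simpa using h1⟩
  · intro h s hs n
    obtain ⟨k, hk, h1⟩ := h s hs (n + 1)
    refine ⟨k - 1, by omega, ?_⟩
    obtain ⟨j, rfl⟩ : ∃ j, k = j + 1 := ⟨k - 1, by omega⟩
    simpa using h1

/-- Components of the closure of a proper open set reach the frontier. -/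
theorem aux_bump {X : Type*} [MetricSpace X] [CompactSpace X] [ConnectedSpace X]
    (U : Set X) (hU : IsOpen U) (hne : U ≠ univ) (x : closure U) :
    ∃ b : closure U, (b : X) ∈ frontier U ∧ b ∈ connectedComponent x := by
  by_contra hcon
  push Not at hcon
  have : CompactSpace (closure U) := isCompact_iff_compactSpace.mp isClosed_closure.isCompact
  let F : Set (closure U) := Subtype.val ⁻¹' frontier U
  have hF : IsClosed F := isClosed_frontier.preimage continuous_subtype_val
  have hdisj : F ∩ ⋂ s : { s : Set (closure U) // IsClopen s ∧ x ∈ s }, (s : Set (closure U)) = ∅ := by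
    rw [← connectedComponent_eq_iInter_isClopen]
    ext b
    simp only [mem_inter_iff, mem_empty_iff_false, iff_false, not_and]
    exact fun hb => hcon b hb
  obtain ⟨Z, hZ, hxZ, hZF⟩ : ∃ Z : Set (closure U), IsClopen Z ∧ x ∈ Z ∧ F ∩ Z = ∅ := by
    obtain ⟨t, ht⟩ := hF.isCompact.elim_finite_subfamily_closed
      (fun s : { s : Set (closure U) // IsClopen s ∧ x ∈ s } => (s : Set (closure U)))
      (fun s => s.2.1.isClosed) hdisj
    refine ⟨⋂ s ∈ t, (s : Set (closure U)), ?_, ?_, ht⟩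
    · exact isClopen_biInter_finset fun s _ => s.2.1
    · simp only [mem_iInter]
      exact fun s _ => s.2.2
  have hZU : Subtype.val '' Z ⊆ U := by
    rintro _ ⟨b, hb, rfl⟩
    by_contra hbU
    have : b ∈ F ∩ Z := ⟨⟨b.2, by rwa [hU.interior_eq]⟩, hb⟩
    rw [hZF] at this
    exact this
  have hcl : IsClosed (Subtype.val '' Z) := isClosed_closure.isClosedMap_subtype_val _ hZ.isClosed
  have hop : IsOpen (Subtype.val '' Z) := by
    obtain ⟨O, hO, hOZ⟩ := isOpen_induced_iff.mp hZ.isOpen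
    have : Subtype.val '' Z = O ∩ U := by
      ext b
      constructor
      · intro hb
        refine ⟨?_, hZU hb⟩
        obtain ⟨b, hb, rfl⟩ := hb
        rw [← hOZ] at hb
        exact hb
      · rintro ⟨h1, h2⟩
        refine ⟨⟨b, subset_closure h2⟩, ?_, rfl⟩
        rw [← hOZ]
        exact h1
    rw [this]
    exact hO.inter hU
  have hun := IsClopen.eq_univ ⟨hcl, hop⟩ ⟨_, x, hxZ, rfl⟩
  exact hne (univ_subset_iff.mp (hun ▸ hZU))

theorem aux_loc {X : Type*} [MetricSpace X] [CompactSpace X] [ConnectedSpace X]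
    (hX : IsRegCurve X) (x : X) (V : Set X) (hV : V ∈ 𝓝 x) :
    ∃ C ∈ 𝓝 x, C ⊆ V ∧ IsPreconnected C := by
  by_cases hVu : V = univ
  · exact ⟨univ, univ_mem, hVu ▸ Subset.rfl, isPreconnected_univ⟩
  obtain ⟨K, hK, hKc, hKV⟩ := exists_mem_nhds_isClosed_subset hV
  obtain ⟨U, hU, hxU, hUK, hfin⟩ := hX x (interior K) isOpen_interior (mem_interior_iff_mem_nhds.mpr hK)
  have hUV : closure U ⊆ V :=
    (closure_minimal (hUK.trans interior_subset) hKc).trans hKV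
  have hUne : U ≠ univ := by
    rintro rfl
    exact hVu (univ_subset_iff.mp (subset_closure.trans hUV))
  let x' : closure U := ⟨x, subset_closure hxU⟩
  let F : Set (closure U) := Subtype.val ⁻¹' frontier U
  have hFfin : F.Finite := hfin.preimage Subtype.val_injective.injOn
  let D : Set (closure U) := ⋃ b ∈ F \ connectedComponent x', connectedComponent b
  have hD : IsClosed D := (hFfin.subset sdiff_subset).isClosed_biUnion
    fun b _ => isClosed_connectedComponent
  have hDx : Dᶜ = connectedComponent x' := by
    ext z
    simp only [D, mem_compl_iff, mem_iUnion, not_exists]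
    constructor
    · intro h
      by_contra hz
      obtain ⟨b, hb, hbz⟩ := aux_bump U hU hUne z
      have e := connectedComponent_eq hbz
      refine h b ⟨hb, fun hbx => ?_⟩ (e ▸ mem_connectedComponent)
      have e2 := connectedComponent_eq hbx
      exact hz (e2 ▸ e ▸ mem_connectedComponent)
    · intro hz b hb hzb
      have e1 := connectedComponent_eq hz
      have e2 := connectedComponent_eq hzb
      exact hb.2 (by rw [e1, ← e2]; exact mem_connectedComponent)
  have hop : IsOpen (connectedComponent x') := hDx ▸ hD.isOpen_compl
  refine ⟨Subtype.val '' connectedComponent x', ?_, ?_, ?_⟩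
  · obtain ⟨O, hO, hOZ⟩ := isOpen_induced_iff.mp hop
    have hxO : x ∈ O := by
      have : x' ∈ Subtype.val ⁻¹' O := hOZ ▸ mem_connectedComponent
      exact this
    refine mem_of_superset ((hO.inter hU).mem_nhds ⟨hxO, hxU⟩) ?_
    rintro z ⟨h1, h2⟩
    refine ⟨⟨z, subset_closure h2⟩, ?_, rfl⟩
    rw [← hOZ]
    exact h1
  · rintro _ ⟨z, _, rfl⟩
    exact hUV z.2
  · exact isPreconnected_connectedComponent.image _ continuous_subtype_val.continuousOn

theorem aux_sep {X : Type*} [MetricSpace X] [CompactSpace X]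
    (hX : IsRegCurve X) (K M : Set X) (hK : IsCompact K) (hM : IsClosed M) (hKM : Disjoint K M) :
    ∃ Q : Set X, IsOpen Q ∧ K ⊆ Q ∧ Disjoint Q M ∧ (frontier Q).Finite := by
  have h : ∀ z : X, z ∈ K → ∃ U : Set X, IsOpen U ∧ z ∈ U ∧ U ⊆ Mᶜ ∧ (frontier U).Finite :=
    fun z hz => hX z Mᶜ hM.isOpen_compl (disjoint_left.mp hKM hz)
  choose! U hU hzU hUM hfin using h
  obtain ⟨t, ht, hKt⟩ := hK.elim_nhds_subcover U fun z hz => (hU z hz).mem_nhds (hzU z hz)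
  refine ⟨⋃ z ∈ t, U z, isOpen_biUnion fun z hz => hU z (ht z hz), hKt, ?_, ?_⟩
  · rw [disjoint_iUnion₂_left]
    exact fun z hz => disjoint_left.mpr fun a ha => hUM z (ht z hz) ha
  · clear hKt
    have : ∀ s : Finset X, (∀ z ∈ s, z ∈ K) → (frontier (⋃ z ∈ s, U z)).Finite := by
      classical
      intro s
      induction s using Finset.induction_on with
      | empty => simp
      | insert a s _ ih =>
        intro hs
        rw [Finset.set_biUnion_insert]
        refine Finite.subset ((hfin a (hs a (by simp))).union (ih fun z hz => hs z (by simp [hz]))) ?_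
        exact (frontier_union_subset _ _).trans
          (union_subset_union inter_subset_left inter_subset_right)
    exact this t ht

theorem aux_image_iter {X : Type*} [MetricSpace X] [CompactSpace X] (f : X → X)
    (hf : Continuous f) (M : Set X) (hM : IsMinimalSet f M) (k : ℕ) (p : X) (hp : p ∈ M) :
    ∃ q ∈ M, f^[k] q = p := by
  obtain ⟨h1, h2, h3, h4⟩ := hM
  have e : f '' M = M := h4 _ h3 (h1.image f) (h2.isCompact.image hf).isClosed (image_mono h3)
  induction k generalizing p with
  | zero => exact ⟨p, hp, rfl⟩
  | succ k ih =>
    obtain ⟨q, hq, rfl⟩ := e.symm ▸ hp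
    obtain ⟨r, hr, rfl⟩ := ih q hq
    exact ⟨r, hr, Function.iterate_succ_apply' f k r⟩

theorem aux_iter_mem {X : Type*} (f : X → X) (M : Set X) (h : f '' M ⊆ M) (p : X) (hp : p ∈ M)
    (k : ℕ) : f^[k] p ∈ M := by
  induction k with
  | zero => exact hp
  | succ k ih => rw [Function.iterate_succ_apply']; exact h ⟨_, ih, rfl⟩

theorem aux_inj {X : Type*} [MetricSpace X] [CompactSpace X] (f : X → X)
    (M : Set X) (hM : IsMinimalSet f M) (hinf : M.Infinite) (p : X) (hp : p ∈ M) :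
    Function.Injective (fun k : ℕ => f^[k] p) := by
  obtain ⟨h1, h2, h3, h4⟩ := hM
  have key : ∀ i j : ℕ, i < j → f^[i] p ≠ f^[j] p := by
    intro i j hij he
    have hper : ∀ n, ∃ m < j, f^[n] p = f^[m] p := by
      intro n
      induction n with
      | zero => exact ⟨0, by omega, rfl⟩
      | succ n ih =>
        obtain ⟨m, hm, e⟩ := ih
        have e' : f^[n + 1] p = f^[m + 1] p := by
          rw [Function.iterate_succ_apply', e, Function.iterate_succ_apply']
        by_cases hmj : m + 1 < j
        · exact ⟨_, hmj, e'⟩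
        · have : m + 1 = j := by omega
          exact ⟨i, hij, by rw [e', this, he]⟩
    have hfin : (range fun k : ℕ => f^[k] p).Finite := by
      refine ((Set.finite_lt_nat j).image (fun k : ℕ => f^[k] p)).subset ?_
      rintro _ ⟨n, rfl⟩
      obtain ⟨m, hm, e⟩ := hper n
      exact ⟨m, hm, e.symm⟩
    have := h4 (range fun k : ℕ => f^[k] p)
      (by rintro _ ⟨n, rfl⟩; exact aux_iter_mem f M h3 p hp n) ⟨_, 0, rfl⟩ hfin.isClosed
      (by rintro _ ⟨_, ⟨n, rfl⟩, rfl⟩; exact ⟨n + 1, Function.iterate_succ_apply' f n p⟩)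
    exact hinf (this ▸ hfin)
  intro i j he
  rcases lt_trichotomy i j with h | h | h
  · exact absurd he (key i j h)
  · exact h
  · exact absurd he.symm (key j i h)

theorem aux_core {X : Type*} [MetricSpace X] [CompactSpace X] [ConnectedSpace X]
    (hX : IsRegCurve X) (f : X → X) (hf : IsMonotoneMap f)
    (M : Set X) (hM : IsMinimalSet f M) (Q : Set X) (hQ : IsOpen Q) (hQM : Disjoint Q M)
    (hfin : (frontier Q).Finite) (p : ℕ → X) (hp : Function.Injective p) (hpM : ∀ i, p i ∈ M) :
    ∃ (N : ℕ) (C : ℕ → Set X), (∀ i, C i ∈ 𝓝 (p i)) ∧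
      ∀ k, ¬ ∀ i < N, ∃ w ∈ Q, f^[k] w ∈ C i := by
  classical
  let R := hfin.toFinset
  let N := R.card + 1
  obtain ⟨V, hV, hVd⟩ := ((Finset.range N).image p).finite_toSet.t2_separation
  have h : ∀ i, ∃ C ∈ 𝓝 (p i), C ⊆ V (p i) ∧ IsPreconnected C := fun i =>
    aux_loc hX (p i) (V (p i)) ((hV _).2.mem_nhds (hV _).1)
  choose C hC hCV hCc using h
  refine ⟨N, C, hC, fun k hk => ?_⟩
  have hpre : ∀ (n : ℕ) (D : Set X), IsPreconnected D → IsPreconnected (f^[n] ⁻¹' D) := by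
    intro n
    induction n with
    | zero => intro D hD; simpa using hD
    | succ n ih =>
      intro D hD
      rw [Function.iterate_succ, preimage_comp]
      exact hf.2 _ (ih D hD)
  have hb : ∀ i < N, ∃ b ∈ R, f^[k] b ∈ C i := by
    intro i hi
    obtain ⟨w, hw, hwC⟩ := hk i hi
    obtain ⟨q, hq, hqp⟩ := aux_image_iter f hf.1 M hM k (p i) (hpM i)
    by_contra hcon
    push Not at hcon
    have hsub : f^[k] ⁻¹' C i ⊆ Q ∪ (closure Q)ᶜ := by
      intro z hz
      by_contra hz'
      simp only [mem_union, mem_compl_iff, not_or, not_not] at hz'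
      exact hcon z (by simp [R, hQ.frontier_eq, hz'.1, hz'.2]) hz
    have hqC : q ∈ f^[k] ⁻¹' C i := by
      rw [mem_preimage, hqp]; exact mem_of_mem_nhds (hC i)
    have hqQ : q ∈ (closure Q)ᶜ :=
      (hsub hqC).resolve_left (disjoint_right.mp hQM hq)
    obtain ⟨z, _, hz1, hz2⟩ := hpre k _ (hCc i) Q (closure Q)ᶜ hQ isClosed_closure.isOpen_compl hsub
      ⟨w, hwC, hw⟩ ⟨q, hqC, hqQ⟩
    exact hz2 (subset_closure hz1)
  choose! b hbR hbC using hb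
  obtain ⟨i, hi, j, hj, hij, hbij⟩ := Finset.exists_ne_map_eq_of_card_lt_of_maps_to
    (s := Finset.range N) (t := R) (f := b) (by simp [N])
    (fun i hi => hbR i (Finset.mem_range.mp hi))
  have hd := hVd (show p i ∈ ((Finset.range N).image p : Set X) from by
      simpa using ⟨i, Finset.mem_range.mp hi, rfl⟩)
    (show p j ∈ ((Finset.range N).image p : Set X) from by
      simpa using ⟨j, Finset.mem_range.mp hj, rfl⟩) (fun h => hij (hp h))
  refine disjoint_left.mp hd (hCV i (hbC i (Finset.mem_range.mp hi))) ?_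
  rw [hbij]
  exact hCV j (hbC j (Finset.mem_range.mp hj))

theorem aux_sub {X : Type*} [MetricSpace X] [CompactSpace X] [ConnectedSpace X]
    (hX : IsRegCurve X) (f : X → X) (hf : IsMonotoneMap f)
    (M : Set X) (hM : IsMinimalSet f M) (hMinf : M.Infinite) (y : X)
    (hy : M ⊆ omegaLimitSet f y) : omegaLimitSet f y ⊆ M := by
  intro z hz
  by_contra hzM
  obtain ⟨Q, hQ, hzQ, hQM, hfin⟩ := aux_sep hX {z} M isCompact_singleton hM.2.1
    (disjoint_singleton_left.mpr hzM)
  rw [aux_mem_omega, mapClusterPt_iff_frequently] at hz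
  obtain ⟨l, hl, hlQ⟩ := extraction_of_frequently_atTop (hz Q (hQ.mem_nhds (hzQ rfl)))
  obtain ⟨p, hp⟩ := hM.1
  obtain ⟨N, C, hC, hcon⟩ := aux_core hX f hf M hM Q hQ hQM hfin (fun i => f^[l i] p)
    ((aux_inj f M hM hMinf p hp).comp hl.injective) (fun i => aux_iter_mem f M hM.2.2.1 p hp _)
  have hW : ∀ᶠ v in 𝓝 p, ∀ i ∈ Finset.range N, f^[l i] v ∈ C i := by
    rw [eventually_all_finset]
    exact fun i _ => (hf.1.iterate (l i)).continuousAt (hC i)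
  have hpω := hy hp
  rw [aux_mem_omega, mapClusterPt_iff_frequently] at hpω
  obtain ⟨k, hk⟩ := (hpω _ hW).exists
  refine hcon k fun i hi => ⟨f^[l i] y, hlQ i, ?_⟩
  rw [← Function.iterate_add_apply, add_comm, Function.iterate_add_apply]
  exact hk i (Finset.mem_range.mpr hi)

theorem aux_meet {X : Type*} [MetricSpace X] [CompactSpace X] [ConnectedSpace X]
    (hX : IsRegCurve X) (f : X → X) (hf : IsMonotoneMap f)
    (M : Set X) (hM : IsMinimalSet f M) (hMinf : M.Infinite) (y : X)
    (hy : y ∈ closure {x : X | omegaLimitSet f x = M}) : (omegaLimitSet f y ∩ M).Nonempty := by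
  rw [← not_disjoint_iff_nonempty_inter]
  intro hd
  obtain ⟨Q, hQ, hKQ, hQM, hfin⟩ := aux_sep hX _ M (aux_closed_omega f y).isCompact hM.2.1 hd
  obtain ⟨J, hJ⟩ : ∃ J, ∀ j ≥ J, f^[j] y ∈ Q := by
    rw [← eventually_atTop]
    by_contra hcon
    rw [not_eventually] at hcon
    obtain ⟨a, ha, hca⟩ := hQ.isClosed_compl.isCompact.exists_mapClusterPt_of_frequently hcon
    exact ha (hKQ ((aux_mem_omega f y a).mpr hca))
  obtain ⟨p, hp⟩ := hM.1
  obtain ⟨N, C, hC, hcon⟩ := aux_core hX f hf M hM Q hQ hQM hfin (fun i => f^[i] p)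
    (aux_inj f M hM hMinf p hp) (fun i => aux_iter_mem f M hM.2.2.1 p hp _)
  have hW : ∀ᶠ v in 𝓝 p, ∀ i ∈ Finset.range N, f^[i] v ∈ C i := by
    rw [eventually_all_finset]
    exact fun i _ => (hf.1.iterate i).continuousAt (hC i)
  have hY : ∀ᶠ v in 𝓝 y, ∀ i ∈ Finset.range N, f^[J + i] v ∈ Q := by
    rw [eventually_all_finset]
    exact fun i _ => (hf.1.iterate (J + i)).continuousAt (hQ.mem_nhds (hJ _ (by omega)))
  obtain ⟨x, hx, hxM⟩ := mem_closure_iff_nhds.mp hy _ hY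
  have hpω : p ∈ omegaLimitSet f x := by
    rw [show omegaLimitSet f x = M from hxM]; exact hp
  rw [aux_mem_omega, mapClusterPt_iff_frequently] at hpω
  obtain ⟨k, hkJ, hk⟩ := frequently_atTop.mp (hpω _ hW) J
  refine hcon (k - J) fun i hi => ⟨f^[J + i] x, hx i (Finset.mem_range.mpr hi), ?_⟩
  rw [← Function.iterate_add_apply, show k - J + (J + i) = i + k by omega,
    Function.iterate_add_apply]
  exact hk i (Finset.mem_range.mpr hi)

theorem stmt_4 {X : Type*} [MetricSpace X] [CompactSpace X] [ConnectedSpace X]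
    (hX : IsRegCurve X) (f : X → X) (hf : IsMonotoneMap f)
    (M : Set X) (hM : IsMinimalSet f M) (hMinf : M.Infinite) :
    f '' {x : X | omegaLimitSet f x = M} ⊆ {x : X | omegaLimitSet f x = M} ∧
      IsClosed {x : X | omegaLimitSet f x = M} := by
  constructor
  · rintro _ ⟨x, hx, rfl⟩
    exact (aux_omega_image f x).trans hx
  · refine isClosed_of_closure_subset fun y hy => ?_
    have hne := aux_meet hX f hf M hM hMinf y hy
    have hsub : M ⊆ omegaLimitSet f y := by
      have := hM.2.2.2 (omegaLimitSet f y ∩ M) inter_subset_right hne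
        ((aux_closed_omega f y).inter hM.2.1) (by
          rintro _ ⟨q, ⟨h1, h2⟩, rfl⟩
          exact ⟨aux_inv_omega f hf.1 y q h1, hM.2.2.1 ⟨q, h2, rfl⟩⟩)
      rw [← this]
      exact inter_subset_left
    exact Subset.antisymm (aux_sub hX f hf M hM hMinf y hsub) hsub
end
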